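/- arXiv:math/9901032 — 3 statements merged into one kernel-verified Lean document; each statement's English description precedes it below -/
import Mathlib

section
/- On the level-l q-deformed Fock space F, the quantum Serre relations hold: for all r ≠ s in ℤ/nℤ, with m = 1 + δ(s ≡ r + 1 mod n) + δ(s ≡ r − 1 mod n), one has Σ_{k=0}^{m} (−1)^k [m choose k]_q e_r^k e_s e_r^{m−k} = 0 and Σ_{k=0}^{m} (−1)^k [m choose k]_q f_r^k f_s f_r^{m−k} = 0 as operators on F, where [m choose k]_q denotes the balanced Gaussian binomial coefficient in ℤ[q, q^{−1}]. -/
/-!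
Shared setup for the level-`l` q-deformed Fock space of `U_q'(sl_n^)` with charge
`sT = (s_1, …, s_l)` (here `sT b` is the paper's `s_{b+1}`; rows and columns of
partitions are 0-indexed, so the node `(i, j, b)` of the paper is `(b, i-1, j-1)`).

* `Ptn` : partitions; `MPtn l` : `l`-multipartitions.
* `addableRow lam b i` : a node can be added to `lam` in component `b`, row `i`;
  the added node then lies in column `(lam b).1 i` and has `d`-value
  `addD sT lam b i = sT b + (lam b).1 i - i` and colour `(addD … : ZMod n)`.
* `removableRow lam b i` : a node can be removed in component `b`, row `i`;
  it has `d`-value `remD sT lam b i = sT b + (lam b).1 i - 1 - i`.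
* `nodeLt` : the total order `(d, b) < (d', b')` on nodes.
* `AddableSet/RemovableSet n l sT lam r` : positions of addable/removable
  `r`-nodes; `Nr` is `N_r(λ)`, and `Ngt/Nlt n l sT lam r γ` are
  `N_r^>(λ,μ)/N_r^<(λ,μ)` for the added node `γ = (d, b)`.
* `AddAt lam mu b i` : `mu` is obtained from `lam` by adding one node in component
  `b`, row `i`; `AddOne n l sT r lam mu` is the relation `μ/λ = r`.
* `Fock l = (MPtn l) →₀ ℚ(q)` with natural basis `phi l lam`; the operators
  `e r, f r, t r, t r ^{-1}` are characterized by their matrix entries in this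
  basis (hypotheses of the theorems below).
-/

noncomputable section

abbrev KK : Type := RatFunc ℚ

/-- the indeterminate `q`. -/
noncomputable def qq : KK := RatFunc.X

def Ptn : Type := {f : ℕ → ℕ // Antitone f ∧ ∃ N : ℕ, ∀ i ≥ N, f i = 0}

abbrev MPtn (l : ℕ) : Type := Fin l → Ptn

def addableRow {l : ℕ} (lam : MPtn l) (b : Fin l) (i : ℕ) : Prop :=
  i = 0 ∨ (lam b).1 i < (lam b).1 (i - 1)

def removableRow {l : ℕ} (lam : MPtn l) (b : Fin l) (i : ℕ) : Prop :=
  (lam b).1 (i + 1) < (lam b).1 i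

def addD {l : ℕ} (sT : Fin l → ℤ) (lam : MPtn l) (b : Fin l) (i : ℕ) : ℤ :=
  sT b + (lam b).1 i - i

def remD {l : ℕ} (sT : Fin l → ℤ) (lam : MPtn l) (b : Fin l) (i : ℕ) : ℤ :=
  sT b + (lam b).1 i - 1 - i

def nodeLt {l : ℕ} (p q : ℤ × Fin l) : Prop :=
  p.1 < q.1 ∨ (p.1 = q.1 ∧ p.2 < q.2)

def AddableSet (n l : ℕ) (sT : Fin l → ℤ) (lam : MPtn l) (r : ZMod n) :
    Set (Fin l × ℕ) :=
  {p | addableRow lam p.1 p.2 ∧ ((addD sT lam p.1 p.2 : ℤ) : ZMod n) = r}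

def RemovableSet (n l : ℕ) (sT : Fin l → ℤ) (lam : MPtn l) (r : ZMod n) :
    Set (Fin l × ℕ) :=
  {p | removableRow lam p.1 p.2 ∧ ((remD sT lam p.1 p.2 : ℤ) : ZMod n) = r}

/-- `N_r(λ)`. -/
def Nr (n l : ℕ) (sT : Fin l → ℤ) (lam : MPtn l) (r : ZMod n) : ℤ :=
  ((AddableSet n l sT lam r).ncard : ℤ) - ((RemovableSet n l sT lam r).ncard : ℤ)

/-- `N_r^>(λ, μ)`, where `γ = (d, b)` is the node added to `λ` to get `μ`. -/
def Ngt (n l : ℕ) (sT : Fin l → ℤ) (lam : MPtn l) (r : ZMod n) (γ : ℤ × Fin l) : ℤ :=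
  (({p : Fin l × ℕ | p ∈ AddableSet n l sT lam r ∧
      nodeLt γ (addD sT lam p.1 p.2, p.1)}).ncard : ℤ)
  - (({p : Fin l × ℕ | p ∈ RemovableSet n l sT lam r ∧
      nodeLt γ (remD sT lam p.1 p.2, p.1)}).ncard : ℤ)

/-- `N_r^<(λ, μ)`, where `γ = (d, b)` is the node added to `λ` to get `μ`. -/
def Nlt (n l : ℕ) (sT : Fin l → ℤ) (lam : MPtn l) (r : ZMod n) (γ : ℤ × Fin l) : ℤ :=
  (({p : Fin l × ℕ | p ∈ AddableSet n l sT lam r ∧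
      nodeLt (addD sT lam p.1 p.2, p.1) γ}).ncard : ℤ)
  - (({p : Fin l × ℕ | p ∈ RemovableSet n l sT lam r ∧
      nodeLt (remD sT lam p.1 p.2, p.1) γ}).ncard : ℤ)

/-- `mu` is obtained from `lam` by adding one node, in component `b`, row `i`. -/
def AddAt {l : ℕ} (lam mu : MPtn l) (b : Fin l) (i : ℕ) : Prop :=
  (mu b).1 i = (lam b).1 i + 1 ∧
  (∀ i' : ℕ, i' ≠ i → (mu b).1 i' = (lam b).1 i') ∧
  (∀ b' : Fin l, b' ≠ b → mu b' = lam b')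

/-- the relation `μ/λ = r`. -/
def AddOne (n l : ℕ) (sT : Fin l → ℤ) (r : ZMod n) (lam mu : MPtn l) : Prop :=
  ∃ (b : Fin l) (i : ℕ), AddAt lam mu b i ∧ ((addD sT lam b i : ℤ) : ZMod n) = r

abbrev Fock (l : ℕ) : Type := MPtn l →₀ KK

/-- the natural basis vector `φ(λ_l, s_l)`. -/
noncomputable def phi (l : ℕ) (lam : MPtn l) : Fock l := Finsupp.single lam 1

/-- the balanced quantum integer `[k]_q = q^{k-1} + q^{k-3} + ⋯ + q^{1-k}`. -/
noncomputable def qInt (k : ℕ) : KK := ∑ i ∈ Finset.range k, qq ^ ((k : ℤ) - 1 - 2 * i)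

/-- the balanced quantum factorial `[m]_q!`. -/
noncomputable def qFact (m : ℕ) : KK := ∏ k ∈ Finset.range m, qInt (k + 1)

/-- the balanced Gaussian binomial coefficient `[m choose k]_q`. -/
noncomputable def qBinom (m k : ℕ) : KK := qFact m / (qFact k * qFact (m - k))

section QuantumSerre

variable {K V : Type*} [Field K] [AddCommGroup V] [Module K V]

/-- The iterated `q`-commutators of `F` with an operator `X` of weight `w`. -/
def serreIter (q : K) (F X : Module.End K V) (w : ℤ) : ℕ → Module.End K V
  | 0 => X
  | N + 1 => F * serreIter q F X w N - q ^ (w - 2 * N) • (serreIter q F X w N * F)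

/-- The coefficient `[N] [w + 1 - N]`, up to the factor `q - q⁻¹`, as a telescoping sum. -/
def serreCoeff (q : K) (w : ℤ) (N : ℕ) : K :=
  ∑ j ∈ Finset.range N, (q ^ (w - 2 * j) - (q ^ (w - 2 * j))⁻¹)

lemma serreCoeff_mul {q : K} (hq0 : q ≠ 0) (w : ℤ) (N : ℕ) :
    (q - q⁻¹) * serreCoeff q w N =
      (q ^ (N : ℤ) - q ^ (-(N : ℤ))) * (q ^ (w + 1 - N) - q ^ ((N : ℤ) - w - 1)) := by
  induction N with
  | zero => simp [serreCoeff]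
  | succ N ih =>
    rw [serreCoeff, Finset.sum_range_succ, mul_add, ← serreCoeff, ih, ← zpow_neg]
    have h1 : q⁻¹ = q ^ (-1 : ℤ) := by simp
    have h2 : q = q ^ (1 : ℤ) := by simp
    conv_lhs => enter [2, 1]; rw [h1]; enter [1]; rw [h2]
    simp only [mul_sub, sub_mul, ← zpow_add₀ hq0]
    push_cast
    ring_nf

lemma serreCoeff_ne_zero {q : K} (hq0 : q ≠ 0) (hq : ∀ k : ℤ, k ≠ 0 → q ^ k ≠ 1) (w : ℤ) (N : ℕ)
    (hN : N ≠ 0) (hwN : w + 1 < N) : serreCoeff q w N ≠ 0 := by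
  have key : ∀ a b : ℤ, a ≠ b → q ^ a - q ^ b ≠ 0 := by
    intro a b hab h
    apply hq (a - b) (sub_ne_zero.2 hab)
    rw [zpow_sub₀ hq0, sub_eq_zero.1 h, div_self (zpow_ne_zero _ hq0)]
  intro h
  have := serreCoeff_mul hq0 w N
  rw [h, mul_zero] at this
  refine mul_ne_zero (key _ _ ?_) (key _ _ ?_) this.symm <;> omega

variable {q : K} {E F X T Ti : Module.End K V} {w : ℤ}

lemma mul_serreIter (hq0 : q ≠ 0) (hTF : T * F = q ^ (-2 : ℤ) • (F * T))
    (hTX : T * X = q ^ w • (X * T)) (N : ℕ) :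
    T * serreIter q F X w N = q ^ (w - 2 * N) • (serreIter q F X w N * T) := by
  induction N with
  | zero => simpa [serreIter] using hTX
  | succ N ih =>
    have e : q ^ (w - 2 * ((N + 1 : ℕ) : ℤ)) = q ^ (-2 : ℤ) * q ^ (w - 2 * N) := by
      rw [← zpow_add₀ hq0]; congr 1; push_cast; ring
    have h1 : T * (F * serreIter q F X w N) =
        (q ^ (-2 : ℤ) * q ^ (w - 2 * N)) • (F * serreIter q F X w N * T) := by
      rw [← mul_assoc, hTF, smul_mul_assoc, mul_assoc, ih, mul_smul_comm, smul_smul, mul_assoc]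
    have h2 : T * (serreIter q F X w N * F) =
        (q ^ (-2 : ℤ) * q ^ (w - 2 * N)) • (serreIter q F X w N * F * T) := by
      rw [← mul_assoc, ih, smul_mul_assoc, mul_assoc, hTF, mul_smul_comm, smul_smul, mul_assoc,
        mul_comm (q ^ (-2 : ℤ))]
    rw [serreIter, e, mul_sub, mul_smul_comm, h1, h2, sub_mul, smul_sub, smul_mul_assoc]
    simp only [smul_smul]
    rw [mul_comm (q ^ (w - 2 * (N : ℤ))) (q ^ (-2 : ℤ) * q ^ (w - 2 * (N : ℤ)))]

lemma commutator_serreIter (hq0 : q ≠ 0) (hT : T * Ti = 1) (hTi : Ti * T = 1)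
    (hEF : (q - q⁻¹) • (E * F - F * E) = T - Ti) (hEX : E * X = X * E)
    (hTF : T * F = q ^ (-2 : ℤ) • (F * T)) (hTX : T * X = q ^ w • (X * T)) (N : ℕ) :
    (q - q⁻¹) • (E * serreIter q F X w (N + 1) - serreIter q F X w (N + 1) * E) =
      serreCoeff q w (N + 1) • (serreIter q F X w N * Ti) := by
  have conj : ∀ (a : K) (A : Module.End K V), a ≠ 0 → T * A = a • (A * T) →
      Ti * A = a⁻¹ • (A * Ti) := by
    intro a A ha h
    have h1 : A * T = a⁻¹ • (T * A) := by rw [h, smul_smul, inv_mul_cancel₀ ha, one_smul]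
    calc Ti * A = Ti * (A * T) * Ti := by rw [mul_assoc, mul_assoc, hT, mul_one]
      _ = a⁻¹ • (A * Ti) := by
        rw [h1, mul_smul_comm, ← mul_assoc, hTi, one_mul, smul_mul_assoc]
  have step : ∀ (a : K) (A : Module.End K V), a ≠ 0 → T * A = a • (A * T) →
      (q - q⁻¹) • (E * (F * A - a • (A * F)) - (F * A - a • (A * F)) * E) =
        (a - a⁻¹) • (A * Ti) + (F * ((q - q⁻¹) • (E * A - A * E))
          - a • ((q - q⁻¹) • (E * A - A * E) * F)) := by
    intro a A ha h
    have h1 : E * (F * A - a • (A * F)) - (F * A - a • (A * F)) * E =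
        (E * F - F * E) * A - a • (A * (E * F - F * E)) +
          (F * (E * A - A * E) - a • ((E * A - A * E) * F)) := by
      simp only [mul_sub, sub_mul, mul_smul_comm, smul_mul_assoc, smul_sub, mul_assoc]
      abel
    have h2 : (q - q⁻¹) • ((E * F - F * E) * A - a • (A * (E * F - F * E))) =
        (a - a⁻¹) • (A * Ti) := by
      rw [smul_sub, smul_comm (q - q⁻¹) a, ← smul_mul_assoc, ← mul_smul_comm, hEF, sub_mul,
        mul_sub, h, conj a A ha h]
      module
    rw [h1, smul_add, h2, smul_sub, smul_comm (q - q⁻¹) a, mul_smul_comm, smul_mul_assoc]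
  have hT' := mul_serreIter hq0 hTF hTX
  induction N with
  | zero =>
    refine (step _ _ (zpow_ne_zero _ hq0) (hT' 0)).trans ?_
    simp [serreIter, hEX, serreCoeff]
  | succ N ih =>
    rw [serreIter, step _ _ (zpow_ne_zero _ hq0) (hT' (N + 1)), ih]
    have hTiF := conj _ _ (zpow_ne_zero _ hq0) hTF
    have e : q ^ (w - 2 * N) = q ^ (w - 2 * ((N + 1 : ℕ) : ℤ)) * (q ^ (-2 : ℤ))⁻¹ := by
      rw [← zpow_neg, ← zpow_add₀ hq0]; congr 1; push_cast; ring
    have h3 : F * (serreCoeff q w (N + 1) • (serreIter q F X w N * Ti)) -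
        q ^ (w - 2 * ((N + 1 : ℕ) : ℤ)) •
          (serreCoeff q w (N + 1) • (serreIter q F X w N * Ti) * F) =
        serreCoeff q w (N + 1) • (serreIter q F X w (N + 1) * Ti) := by
      rw [smul_mul_assoc, mul_assoc _ Ti F, hTiF, serreIter, e]
      simp only [sub_mul, smul_sub, mul_smul_comm, smul_mul_assoc, smul_smul, mul_assoc]
      congr 2
      ring
    rw [h3, ← add_smul, add_comm]
    congr 1
    rw [serreCoeff, serreCoeff, Finset.sum_range_succ _ (N + 1)]

/-- A vector of weight `w` in the centralizer of `E` is killed by the `(w + 1)`-st iterated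
`q`-commutator with `F`, provided these commutators are locally eventually zero. -/
lemma serreIter_eq_zero (hq0 : q ≠ 0) (hq : ∀ k : ℤ, k ≠ 0 → q ^ k ≠ 1) (hT : T * Ti = 1)
    (hTi : Ti * T = 1) (hEF : (q - q⁻¹) • (E * F - F * E) = T - Ti) (hEX : E * X = X * E)
    (hTF : T * F = q ^ (-2 : ℤ) • (F * T)) (hTX : T * X = q ^ w • (X * T))
    (hW : ∀ v : V, ∃ W : Submodule K V, v ∈ W ∧ (∀ u ∈ W, E u ∈ W) ∧ (∀ u ∈ W, T u ∈ W) ∧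
      ∃ N₀ : ℕ, ∀ N ≥ N₀, ∀ u ∈ W, serreIter q F X w N u = 0)
    (m : ℕ) (hm : w < m) : serreIter q F X w m = 0 := by
  ext v
  obtain ⟨W, hv, hWE, hWT, N₀, hN₀⟩ := hW v
  have descend : ∀ k N : ℕ, m ≤ N → N₀ ≤ N + k → ∀ u ∈ W, serreIter q F X w N u = 0 := by
    intro k
    induction k with
    | zero => exact fun N _ h u hu => hN₀ N h u hu
    | succ k ih =>
      intro N hN hk u hu
      have h0 := ih (N + 1) (by omega) (by omega)
      have hc := congrArg (fun A : Module.End K V => A (T u))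
        (commutator_serreIter hq0 hT hTi hEF hEX hTF hTX N)
      have hTu : Ti (T u) = u := by
        rw [← Module.End.mul_apply, hTi, Module.End.one_apply]
      simp only [LinearMap.smul_apply, LinearMap.sub_apply, Module.End.mul_apply,
        h0 _ (hWT u hu), h0 _ (hWE _ (hWT u hu)), hTu, map_zero, sub_zero, smul_zero] at hc
      exact (smul_eq_zero.1 hc.symm).resolve_left
        (serreCoeff_ne_zero hq0 hq w (N + 1) (by omega) (by push_cast; omega))
  simpa using descend N₀ m le_rfl (by omega) v hv

end QuantumSerre

lemma qq_ne_zero : qq ≠ 0 := RatFunc.X_ne_zero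

lemma qq_zpow_ne_one (k : ℤ) (hk : k ≠ 0) : qq ^ k ≠ 1 := by
  have nat : ∀ j : ℕ, j ≠ 0 → qq ^ j ≠ 1 := by
    intro j hj h
    have h1 : algebraMap (Polynomial ℚ) (RatFunc ℚ) (Polynomial.X ^ j) =
        algebraMap (Polynomial ℚ) (RatFunc ℚ) 1 := by
      rw [map_pow, RatFunc.algebraMap_X, map_one]
      exact h
    have h2 := congrArg Polynomial.natDegree (RatFunc.algebraMap_injective ℚ h1)
    rw [Polynomial.natDegree_X_pow, Polynomial.natDegree_one] at h2
    exact hj h2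
  obtain ⟨j, rfl | rfl⟩ := k.eq_nat_or_neg
  · simpa using nat j (by simpa using hk)
  · simpa using nat j (by simpa using hk)

lemma qInt_one : qInt 1 = 1 := by simp [qInt]

lemma qInt_two : qInt 2 = qq + qq⁻¹ := by
  have h : (2 : ℤ) - 1 = 1 := by norm_num
  simp [qInt, Finset.sum_range_succ, h]

lemma qInt_three : qInt 3 = qq ^ 2 + 1 + (qq ^ 2)⁻¹ := by
  have h'' : (3 : ℤ) - 1 = 2 := by norm_num
  simp [qInt, Finset.sum_range_succ, h'']

lemma qInt_two_ne_zero : qInt 2 ≠ 0 := by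
  rw [qInt_two]
  intro h
  apply qq_zpow_ne_one 4 (by norm_num)
  have h0 := qq_ne_zero
  field_simp at h
  rw [zpow_ofNat]
  linear_combination (qq ^ 2 - 1) * h

lemma qInt_three_ne_zero : qInt 3 ≠ 0 := by
  rw [qInt_three]
  intro h
  apply qq_zpow_ne_one 6 (by norm_num)
  have h0 := qq_ne_zero
  field_simp at h
  rw [zpow_ofNat]
  linear_combination (qq ^ 2 - 1) * h

lemma serreIter_one_two {K V : Type*} [Field K] [AddCommGroup V] [Module K V] {q : K} (hq : q ≠ 0)
    (F X : Module.End K V) :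
    serreIter q F X 1 2 = X * F ^ 2 - (q + q⁻¹) • (F * X * F) + F ^ 2 * X := by
  have e1 : (1 : ℤ) - 2 * ((0 : ℕ) : ℤ) = 1 := by norm_num
  have e2 : (1 : ℤ) - 2 * ((1 : ℕ) : ℤ) = -1 := by norm_num
  simp only [serreIter, e1, e2, mul_sub, sub_mul, mul_smul_comm, smul_mul_assoc, smul_sub,
    smul_smul, zpow_one, zpow_neg_one, sq, mul_assoc, inv_mul_cancel₀ hq]
  module

lemma serreIter_two_three {K V : Type*} [Field K] [AddCommGroup V] [Module K V] {q : K}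
    (hq : q ≠ 0) (F X : Module.End K V) :
    serreIter q F X 2 3 = F ^ 3 * X - (q ^ 2 + 1 + (q ^ 2)⁻¹) • (F ^ 2 * X * F)
      + (q ^ 2 + 1 + (q ^ 2)⁻¹) • (F * X * F ^ 2) - X * F ^ 3 := by
  have e1 : (2 : ℤ) - 2 * ((0 : ℕ) : ℤ) = 2 := by norm_num
  have e2 : (2 : ℤ) - 2 * ((1 : ℕ) : ℤ) = 0 := by norm_num
  have e3 : (2 : ℤ) - 2 * ((2 : ℕ) : ℤ) = -2 := by norm_num
  have e4 : q ^ (-2 : ℤ) = (q ^ 2)⁻¹ := by rw [zpow_neg]; norm_cast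
  have e5 : q ^ (2 : ℤ) = q ^ 2 := by norm_cast
  have e6 : (q ^ 2)⁻¹ * q ^ 2 = 1 := inv_mul_cancel₀ (pow_ne_zero _ hq)
  simp only [serreIter, e1, e2, e3, e4, e5]
  generalize (q ^ 2)⁻¹ = u at *
  generalize q ^ 2 = t at *
  simp only [mul_sub, sub_mul, mul_smul_comm, smul_mul_assoc, smul_sub, smul_smul, zpow_zero,
    one_smul, pow_succ, pow_zero, one_mul, mul_assoc, e6]
  module

/-- The quantum Serre element is, up to sign, an iterated `q`-commutator. -/
lemma sum_qBinom_eq_serreIter {V : Type*} [AddCommGroup V] [Module KK V]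
    (F X : Module.End KK V) (m : ℕ) (hm : 1 ≤ m) (hm' : m ≤ 3) :
    ∑ k ∈ Finset.range (m + 1), ((-1 : KK) ^ k * qBinom m k) • (F ^ k * X * F ^ (m - k)) =
      (-1 : KK) ^ m • serreIter qq F X ((m : ℤ) - 1) m := by
  have h0 := qq_ne_zero
  have h2 := qInt_two_ne_zero
  have h3 := qInt_three_ne_zero
  interval_cases m
  · simp [Finset.sum_range_succ, serreIter, qBinom, qFact, qInt_one]
    abel
  · have e : ((2 : ℕ) : ℤ) - 1 = 1 := by norm_num
    have b0 : qBinom 2 0 = 1 := by simp [qBinom, qFact, Finset.prod_range_succ, qInt_one, h2]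
    have b1 : qBinom 2 1 = qq + qq⁻¹ := by
      simp [qBinom, qFact, Finset.prod_range_succ, qInt_one, qInt_two]
    have b2 : qBinom 2 2 = 1 := by simp [qBinom, qFact, Finset.prod_range_succ, qInt_one, h2]
    rw [e, serreIter_one_two h0]
    generalize qq + qq⁻¹ = t at *
    simp [Finset.sum_range_succ, b0, b1, b2]
    abel
  · have e : ((3 : ℕ) : ℤ) - 1 = 2 := by norm_num
    have b0 : qBinom 3 0 = 1 := by
      simp [qBinom, qFact, Finset.prod_range_succ, qInt_one, h2, h3]
    have b1 : qBinom 3 1 = qq ^ 2 + 1 + (qq ^ 2)⁻¹ := by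
      rw [← qInt_three]
      simp [qBinom, qFact, Finset.prod_range_succ, qInt_one]
      field_simp
    have b2 : qBinom 3 2 = qq ^ 2 + 1 + (qq ^ 2)⁻¹ := by
      rw [← qInt_three]
      simp [qBinom, qFact, Finset.prod_range_succ, qInt_one]
      field_simp
    have b3 : qBinom 3 3 = 1 := by
      simp [qBinom, qFact, Finset.prod_range_succ, qInt_one, h2, h3]
    rw [e, serreIter_two_three h0]
    generalize qq ^ 2 + 1 + (qq ^ 2)⁻¹ = t at *
    have e3 : (-1 : KK) ^ 3 = -1 := by norm_num
    simp [Finset.sum_range_succ, b0, b1, b2, b3, e3]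
    abel

/-! ### Sites and the bead configuration of a multipartition -/

/-- The neighbouring site of content one larger. -/
def siteUp {l : ℕ} (x : ℤ × Fin l) : ℤ × Fin l := (x.1 + 1, x.2)

/-- The neighbouring site of content one smaller. -/
def siteDown {l : ℕ} (x : ℤ × Fin l) : ℤ × Fin l := (x.1 - 1, x.2)

lemma siteUp_injective {l : ℕ} : Function.Injective (siteUp : ℤ × Fin l → ℤ × Fin l) := by
  rintro ⟨a, b⟩ ⟨c, d⟩ h
  simpa [siteUp] using h

lemma siteUp_ne {l : ℕ} (x : ℤ × Fin l) : siteUp x ≠ x := by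
  rcases x with ⟨a, b⟩
  simp [siteUp]

lemma siteUp_eq_iff {l : ℕ} (x y : ℤ × Fin l) : siteUp x = y ↔ x = siteDown y := by
  rcases x with ⟨a, b⟩
  rcases y with ⟨c, d⟩
  simp only [siteUp, siteDown, Prod.mk.injEq]
  constructor <;> rintro ⟨h, rfl⟩ <;> exact ⟨by omega, rfl⟩

open Classical in
/-- The indicator function of the bead configuration of `lam`. -/
def occ {l : ℕ} (sT : Fin l → ℤ) (lam : MPtn l) (x : ℤ × Fin l) : ℤ :=
  if ∃ i, addD sT lam x.2 i = x.1 then 1 else 0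

section Occupation

variable {l : ℕ} {sT : Fin l → ℤ} {lam mu : MPtn l}

lemma addD_strictAnti (sT : Fin l → ℤ) (lam : MPtn l) (b : Fin l) :
    StrictAnti (addD sT lam b) := by
  intro i j hij
  have := (lam b).2.1 hij.le
  simp only [addD]
  omega

lemma occ_eq_one_iff {x : ℤ × Fin l} : occ sT lam x = 1 ↔ ∃ i, addD sT lam x.2 i = x.1 := by
  simp [occ]

lemma occ_eq_zero_iff {x : ℤ × Fin l} : occ sT lam x = 0 ↔ ¬ ∃ i, addD sT lam x.2 i = x.1 := by
  simp [occ]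

lemma occ_eq_zero_or_one (sT : Fin l → ℤ) (lam : MPtn l) (x : ℤ × Fin l) :
    occ sT lam x = 0 ∨ occ sT lam x = 1 := by
  unfold occ
  split_ifs <;> simp

lemma occ_congr {x : ℤ × Fin l}
    (h : (∃ i, addD sT lam x.2 i = x.1) ↔ ∃ i, addD sT mu x.2 i = x.1) :
    occ sT lam x = occ sT mu x := by
  rcases occ_eq_zero_or_one sT mu x with h0 | h0 <;> rw [h0]
  · exact occ_eq_zero_iff.2 (h.not.2 (occ_eq_zero_iff.1 h0))
  · exact occ_eq_one_iff.2 (h.2 (occ_eq_one_iff.1 h0))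

lemma occ_injective (h : ∀ x, occ sT lam x = occ sT mu x) : lam = mu := by
  funext b
  have hr : Set.range (fun i => -addD sT lam b i) = Set.range (fun i => -addD sT mu b i) := by
    ext d
    have h1 := h (-d, b)
    have : (∃ i, addD sT lam b i = -d) ↔ ∃ i, addD sT mu b i = -d := by
      rw [← occ_eq_one_iff (x := (-d, b)), ← occ_eq_one_iff (x := (-d, b)), h1]
    simpa [Set.mem_range, neg_eq_iff_eq_neg] using this
  have hf := (StrictMono.range_inj (addD_strictAnti sT lam b).neg
    (addD_strictAnti sT mu b).neg).1 hr
  apply Subtype.ext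
  funext i
  have := congrFun hf i
  simp only [addD] at this
  omega

lemma addableRow_iff_occ (b : Fin l) (i : ℕ) :
    addableRow lam b i ↔ occ sT lam (siteUp (addD sT lam b i, b)) = 0 := by
  rw [occ_eq_zero_iff]
  simp only [siteUp]
  constructor
  · rintro h ⟨j, hj⟩
    have hji : j < i := (addD_strictAnti sT lam b).lt_iff_gt.1 (by omega)
    have := (lam b).2.1 (show j ≤ i - 1 by omega)
    rcases h with h | h
    · omega
    · simp only [addD] at hj
      omega
  · intro h
    by_contra hn
    simp only [addableRow, not_or, not_lt] at hn
    apply h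
    have := (lam b).2.1 (show i - 1 ≤ i by omega)
    refine ⟨i - 1, ?_⟩
    simp only [addD]
    omega

lemma removableRow_iff_occ (b : Fin l) (i : ℕ) :
    removableRow lam b i ↔ occ sT lam (remD sT lam b i, b) = 0 := by
  rw [occ_eq_zero_iff]
  constructor
  · rintro h ⟨j, hj⟩
    simp only [removableRow] at h
    have hji : i < j := (addD_strictAnti sT lam b).lt_iff_gt.1 (by simp only [addD, remD] at *; omega)
    have := (lam b).2.1 (show i + 1 ≤ j by omega)
    simp only [addD, remD] at hj
    omega
  · intro h
    by_contra hn
    simp only [removableRow, not_lt] at hn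
    apply h
    have := (lam b).2.1 (show i ≤ i + 1 by omega)
    refine ⟨i + 1, ?_⟩
    simp only [addD, remD]
    push_cast
    omega

/-- `mu` is obtained from `lam` by adding a node at the site `x`. -/
def AddSite (sT : Fin l → ℤ) (lam mu : MPtn l) (x : ℤ × Fin l) : Prop :=
  ∃ i, AddAt lam mu x.2 i ∧ addD sT lam x.2 i = x.1

lemma AddSite.occ_eq {x : ℤ × Fin l} (h : AddSite sT lam mu x) :
    occ sT lam x = 1 ∧ occ sT lam (siteUp x) = 0 ∧
      ∀ z, occ sT mu z =
        occ sT lam z - (if x = z then 1 else 0) + (if siteUp x = z then 1 else 0) := by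
  obtain ⟨d, b⟩ := x
  obtain ⟨i, ⟨hi, hrow, hcomp⟩, hd⟩ := h
  simp only at hd hi hrow hcomp
  have hmu : addD sT mu b i = d + 1 := by
    simp only [addD] at hd ⊢
    rw [hi]; push_cast; omega
  have hother : ∀ j, j ≠ i → addD sT mu b j = addD sT lam b j := by
    intro j hj
    simp only [addD, hrow j hj]
  have injl := (addD_strictAnti sT lam b).injective
  have injm := (addD_strictAnti sT mu b).injective
  have h1 : occ sT lam (d, b) = 1 := occ_eq_one_iff.2 ⟨i, hd⟩
  have h2 : occ sT lam (d + 1, b) = 0 := by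
    rw [occ_eq_zero_iff]
    rintro ⟨j, hj⟩
    simp only at hj
    have hji : j ≠ i := by rintro rfl; omega
    exact hji (injm (by rw [hother j hji, hj, hmu]))
  refine ⟨h1, h2, ?_⟩
  rintro ⟨d', b'⟩
  simp only [siteUp, Prod.mk.injEq]
  by_cases hb : b = b'
  · subst hb
    simp only [and_true]
    by_cases hd1 : d = d'
    · subst hd1
      have : occ sT mu (d, b) = 0 := by
        rw [occ_eq_zero_iff]
        rintro ⟨j, hj⟩
        simp only at hj
        have hji : j ≠ i := by rintro rfl; omega
        exact hji (injl (by rw [← hother j hji, hj, hd]))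
      simp [this, h1]
    · by_cases hd2 : d + 1 = d'
      · subst hd2
        have : occ sT mu (d + 1, b) = 1 := occ_eq_one_iff.2 ⟨i, hmu⟩
        simp [this, h2]
      · simp only [hd1, hd2, if_false, sub_zero, add_zero]
        have : (∃ j, addD sT mu b j = d') ↔ ∃ j, addD sT lam b j = d' := by
          constructor
          · rintro ⟨j, hj⟩
            have hji : j ≠ i := by rintro rfl; omega
            exact ⟨j, by rw [← hother j hji, hj]⟩
          · rintro ⟨j, hj⟩
            have hji : j ≠ i := by rintro rfl; omega
            exact ⟨j, by rw [hother j hji, hj]⟩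
        exact occ_congr this
  · simp only [hb, and_false, if_false, sub_zero, add_zero]
    exact occ_congr (by simp only [addD, hcomp b' (Ne.symm hb)])

lemma exists_addSite {x : ℤ × Fin l} (h1 : occ sT lam x = 1) (h2 : occ sT lam (siteUp x) = 0) :
    ∃ mu, AddSite sT lam mu x := by
  obtain ⟨d, b⟩ := x
  obtain ⟨i, hi⟩ := occ_eq_one_iff.1 h1
  simp only at hi
  have hrow : addableRow lam b i := (addableRow_iff_occ (sT := sT) b i).2 (by rw [hi]; exact h2)
  obtain ⟨N, hN⟩ := (lam b).2.2
  let p : Ptn := ⟨Function.update (lam b).1 i ((lam b).1 i + 1), by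
    refine ⟨antitone_nat_of_succ_le fun j => ?_, max N (i + 1), fun j hj => ?_⟩
    · have hj := (lam b).2.1 (Nat.le_succ j)
      rcases eq_or_ne j i with rfl | hji
      · rw [Function.update_self, Function.update_of_ne (by omega)]
        exact hj.trans (Nat.le_succ _)
      · rw [Function.update_of_ne hji]
        rcases eq_or_ne (j + 1) i with rfl | hji'
        · rw [Function.update_self]
          simpa [addableRow] using hrow
        · rw [Function.update_of_ne hji']
          exact hj
    · rw [Function.update_of_ne (by omega)]
      exact hN j (by omega)⟩
  have hp : Function.update lam b p b = p := Function.update_self b p lam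
  refine ⟨Function.update lam b p, i, ⟨?_, fun j hj => ?_, fun b' hb' => ?_⟩, hi⟩
  · dsimp only
    rw [hp]
    exact Function.update_self i _ _
  · dsimp only
    rw [hp]
    exact Function.update_of_ne hj _ _
  · simp [Function.update_of_ne hb']

lemma exists_addSite_of_removable {x : ℤ × Fin l} (h1 : occ sT mu x = 0)
    (h2 : occ sT mu (siteUp x) = 1) : ∃ lam, AddSite sT lam mu x := by
  obtain ⟨d, b⟩ := x
  obtain ⟨i, hi⟩ := occ_eq_one_iff.1 h2
  simp only [siteUp] at hi
  have hd : remD sT mu b i = d := by simp only [addD, remD] at *; omega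
  have hrow : (mu b).1 (i + 1) < (mu b).1 i :=
    (removableRow_iff_occ (sT := sT) b i).2 (by rw [hd]; exact h1)
  obtain ⟨N, hN⟩ := (mu b).2.2
  let p : Ptn := ⟨Function.update (mu b).1 i ((mu b).1 i - 1), by
    refine ⟨antitone_nat_of_succ_le fun j => ?_, N, fun j hj => ?_⟩
    · have hj := (mu b).2.1 (Nat.le_succ j)
      rcases eq_or_ne j i with rfl | hji
      · rw [Function.update_self, Function.update_of_ne (by omega)]
        omega
      · rw [Function.update_of_ne hji]
        rcases eq_or_ne (j + 1) i with rfl | hji'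
        · rw [Function.update_self]
          exact (Nat.sub_le _ _).trans hj
        · rw [Function.update_of_ne hji']
          exact hj
    · have := hN j hj
      rcases eq_or_ne j i with rfl | hji
      · omega
      · rw [Function.update_of_ne hji, this]⟩
  have hpi : p.1 i = (mu b).1 i - 1 := Function.update_self i _ _
  have hp : Function.update mu b p b = p := Function.update_self b p mu
  refine ⟨Function.update mu b p, i, ⟨?_, fun j hj => ?_, fun b' hb' => ?_⟩, ?_⟩
  · dsimp only
    rw [hp, hpi]
    omega
  · dsimp only
    rw [hp]
    exact (Function.update_of_ne hj _ _).symm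
  · simp [Function.update_of_ne hb']
  · simp only [addD] at hi ⊢
    rw [hp, hpi]
    omega

lemma AddSite.of_occ {x : ℤ × Fin l} (h1 : occ sT lam x = 1) (h2 : occ sT lam (siteUp x) = 0)
    (h : ∀ z, occ sT mu z =
      occ sT lam z - (if x = z then 1 else 0) + (if siteUp x = z then 1 else 0)) :
    AddSite sT lam mu x := by
  obtain ⟨mu', hmu'⟩ := exists_addSite h1 h2
  have : mu' = mu := occ_injective fun z => by rw [hmu'.occ_eq.2.2 z, h z]
  exact this ▸ hmu'

lemma AddSite.occ_right {x : ℤ × Fin l} (h : AddSite sT lam mu x) :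
    occ sT mu x = 0 ∧ occ sT mu (siteUp x) = 1 := by
  obtain ⟨h1, h2, h3⟩ := h.occ_eq
  rw [h3, h3, h1, h2]
  simp [siteUp_ne, (siteUp_ne x).symm]

lemma AddSite.right_unique {nu : MPtn l} {x : ℤ × Fin l} (h : AddSite sT lam mu x)
    (h' : AddSite sT lam nu x) : mu = nu :=
  occ_injective (sT := sT) fun z => by rw [h.occ_eq.2.2 z, h'.occ_eq.2.2 z]

lemma AddSite.left_unique {nu : MPtn l} {x : ℤ × Fin l} (h : AddSite sT mu lam x)
    (h' : AddSite sT nu lam x) : mu = nu :=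
  occ_injective (sT := sT) fun z => by
    have h1 := h.occ_eq.2.2 z
    have h2 := h'.occ_eq.2.2 z
    omega

lemma AddSite.site_unique {x y : ℤ × Fin l} (h : AddSite sT lam mu x)
    (h' : AddSite sT lam mu y) : x = y := by
  have h1 := h.occ_eq.2.2 x
  have h2 := h'.occ_eq.2.2 x
  by_contra hxy
  simp only [siteUp_ne, if_true, if_false, Ne.symm hxy] at h1 h2
  split_ifs at h2 <;> omega

end Occupation

/-! ### The charge of a multipartition -/

section Charge

variable {l : ℕ} {sT : Fin l → ℤ} {lam mu : MPtn l}

lemma finite_support_charge (sT : Fin l → ℤ) (lam : MPtn l) :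
    (Function.support fun x => occ sT lam x - occ sT lam (siteUp x)).Finite := by
  choose N hN using fun b => (lam b).2.2
  refine Set.Finite.subset (Set.finite_iUnion fun b : Fin l =>
    (Set.finite_Icc (sT b - N b) (sT b + (lam b).1 0)).prod (Set.finite_singleton b)) ?_
  rintro ⟨d, b⟩ hx
  simp only [Set.mem_iUnion]
  refine ⟨b, ?_, rfl⟩
  simp only [Set.mem_Icc]
  have low : ∀ d', d' ≤ sT b - N b → occ sT lam (d', b) = 1 := by
    intro d' hd'
    refine occ_eq_one_iff.2 ⟨(sT b - d').toNat, ?_⟩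
    have := hN b (sT b - d').toNat (by omega)
    simp only [addD, this]
    omega
  have high : ∀ d', sT b + (lam b).1 0 < d' → occ sT lam (d', b) = 0 := by
    rintro d' hd'
    rw [occ_eq_zero_iff]
    rintro ⟨i, hi⟩
    have := (lam b).2.1 (Nat.zero_le i)
    simp only [addD] at hi
    omega
  by_contra hn
  apply hx
  simp only [siteUp]
  by_cases h : d < sT b - N b
  · rw [low d (by omega), low (d + 1) (by omega), sub_self]
  · rw [high d (by omega), high (d + 1) (by omega), sub_self]

/-- The charge is `1` at addable sites, `-1` at removable ones and `0` elsewhere. -/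
def charge (sT : Fin l → ℤ) (lam : MPtn l) : (ℤ × Fin l) →₀ ℤ :=
  Finsupp.ofSupportFinite _ (finite_support_charge sT lam)

lemma charge_apply (x : ℤ × Fin l) :
    charge sT lam x = occ sT lam x - occ sT lam (siteUp x) := rfl

/-- The change of charge when a node is added at the site `x`. -/
def bump (x : ℤ × Fin l) : (ℤ × Fin l) →₀ ℤ :=
  Finsupp.single (siteDown x) 1 + Finsupp.single (siteUp x) 1 - Finsupp.single x 2

lemma AddSite.charge_eq {x : ℤ × Fin l} (h : AddSite sT lam mu x) :
    charge sT mu = charge sT lam + bump x := by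
  ext z
  simp only [charge_apply, bump, Finsupp.add_apply, Finsupp.sub_apply, Finsupp.single_apply,
    h.occ_eq.2.2, siteUp_injective.eq_iff]
  have h1 : x = siteUp z ↔ siteDown x = z := by rw [eq_comm, siteUp_eq_iff, eq_comm]
  simp only [h1]
  split_ifs <;> omega

open Classical in
/-- The total charge of the sites satisfying `P`. -/
def chargeSum (P : ℤ × Fin l → Prop) : ((ℤ × Fin l) →₀ ℤ) →ₗ[ℤ] ℤ :=
  Finsupp.linearCombination ℤ fun z => if P z then (1 : ℤ) else 0

lemma chargeSum_single (P : ℤ × Fin l → Prop) (x : ℤ × Fin l) (a : ℤ) [Decidable (P x)] :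
    chargeSum P (Finsupp.single x a) = if P x then a else 0 := by
  by_cases h : P x <;> simp [chargeSum, h]

open Classical in
lemma chargeSum_apply (P : ℤ × Fin l → Prop) (c : (ℤ × Fin l) →₀ ℤ) (S : Finset (ℤ × Fin l))
    (hS : c.support ⊆ S) : chargeSum P c = ∑ x ∈ S with P x, c x := by
  rw [chargeSum, Finsupp.linearCombination_apply, Finsupp.sum_of_support_subset _ hS _ (by simp),
    Finset.sum_filter]
  simp

lemma charge_eq_one_iff {x : ℤ × Fin l} :
    charge sT lam x = 1 ↔ occ sT lam x = 1 ∧ occ sT lam (siteUp x) = 0 := by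
  rw [charge_apply]
  rcases occ_eq_zero_or_one sT lam x with h | h <;>
    rcases occ_eq_zero_or_one sT lam (siteUp x) with h' | h' <;> rw [h, h'] <;> simp

lemma charge_eq_neg_one_iff {x : ℤ × Fin l} :
    charge sT lam x = -1 ↔ occ sT lam x = 0 ∧ occ sT lam (siteUp x) = 1 := by
  rw [charge_apply]
  rcases occ_eq_zero_or_one sT lam x with h | h <;>
    rcases occ_eq_zero_or_one sT lam (siteUp x) with h' | h' <;> rw [h, h'] <;> simp

lemma charge_cases (sT : Fin l → ℤ) (lam : MPtn l) (x : ℤ × Fin l) :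
    charge sT lam x = 0 ∨ charge sT lam x = 1 ∨ charge sT lam x = -1 := by
  rw [charge_apply]
  rcases occ_eq_zero_or_one sT lam x with h | h <;>
    rcases occ_eq_zero_or_one sT lam (siteUp x) with h' | h' <;> rw [h, h'] <;> simp

lemma ncard_addable (sT : Fin l → ℤ) (lam : MPtn l) (P : ℤ × Fin l → Prop) :
    {p : Fin l × ℕ | addableRow lam p.1 p.2 ∧ P (addD sT lam p.1 p.2, p.1)}.ncard =
      {x | charge sT lam x = 1 ∧ P x}.ncard := by
  have hinj : Function.Injective fun p : Fin l × ℕ => (addD sT lam p.1 p.2, p.1) := by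
    rintro ⟨b, i⟩ ⟨b', i'⟩ h
    obtain ⟨h1, h2⟩ := Prod.mk.inj h
    obtain rfl : b = b' := h2
    obtain rfl : i = i' := (addD_strictAnti sT lam b).injective h1
    rfl
  rw [← Set.ncard_image_of_injective _ hinj]
  congr 1
  ext ⟨d, b⟩
  simp only [Set.mem_image, Set.mem_ofPred_eq, charge_eq_one_iff]
  constructor
  · rintro ⟨⟨b', i⟩, ⟨h1, h2⟩, h3⟩
    rw [← h3]
    exact ⟨⟨occ_eq_one_iff.2 ⟨i, rfl⟩, (addableRow_iff_occ _ _).1 h1⟩, h2⟩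
  · rintro ⟨⟨h1, h2⟩, h3⟩
    obtain ⟨i, hi⟩ := occ_eq_one_iff.1 h1
    simp only at hi
    subst hi
    exact ⟨(b, i), ⟨(addableRow_iff_occ b i).2 h2, h3⟩, rfl⟩

lemma ncard_removable (sT : Fin l → ℤ) (lam : MPtn l) (P : ℤ × Fin l → Prop) :
    {p : Fin l × ℕ | removableRow lam p.1 p.2 ∧ P (remD sT lam p.1 p.2, p.1)}.ncard =
      {x | charge sT lam x = -1 ∧ P x}.ncard := by
  have hrem : ∀ b i, remD sT lam b i + 1 = addD sT lam b i := by
    intro b i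
    simp only [remD, addD]
    ring
  have hinj : Function.Injective fun p : Fin l × ℕ => (remD sT lam p.1 p.2, p.1) := by
    rintro ⟨b, i⟩ ⟨b', i'⟩ h
    obtain ⟨h1, h2⟩ := Prod.mk.inj h
    obtain rfl : b = b' := h2
    obtain rfl : i = i' := (addD_strictAnti sT lam b).injective (by
      have h3 := hrem b i
      have h4 := hrem b i'
      dsimp only at h1
      omega)
    rfl
  rw [← Set.ncard_image_of_injective _ hinj]
  congr 1
  ext ⟨d, b⟩
  simp only [Set.mem_image, Set.mem_ofPred_eq, charge_eq_neg_one_iff]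
  constructor
  · rintro ⟨⟨b', i⟩, ⟨h1, h2⟩, h3⟩
    rw [← h3]
    exact ⟨⟨(removableRow_iff_occ _ _).1 h1, occ_eq_one_iff.2 ⟨i, (hrem b' i).symm⟩⟩, h2⟩
  · rintro ⟨⟨h1, h2⟩, h3⟩
    obtain ⟨i, hi⟩ := occ_eq_one_iff.1 h2
    simp only [siteUp] at hi
    obtain rfl : remD sT lam b i = d := by have := hrem b i; omega
    exact ⟨(b, i), ⟨(removableRow_iff_occ b i).2 h1, h3⟩, rfl⟩

lemma ncard_sub_ncard (sT : Fin l → ℤ) (lam : MPtn l) (P : ℤ × Fin l → Prop) :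
    ({p : Fin l × ℕ | addableRow lam p.1 p.2 ∧ P (addD sT lam p.1 p.2, p.1)}.ncard : ℤ) -
      ({p : Fin l × ℕ | removableRow lam p.1 p.2 ∧ P (remD sT lam p.1 p.2, p.1)}.ncard : ℤ) =
      chargeSum P (charge sT lam) := by
  classical
  rw [ncard_addable, ncard_removable, chargeSum_apply P _ _ subset_rfl]
  have coe : ∀ a : ℤ, a ≠ 0 → {x | charge sT lam x = a ∧ P x} =
      ↑{x ∈ (charge sT lam).support | charge sT lam x = a ∧ P x} := by
    intro a ha
    ext x
    simp only [Set.mem_ofPred_eq, Finset.coe_filter, Finsupp.mem_support_iff]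
    exact ⟨fun h => ⟨by rw [h.1]; exact ha, h⟩, fun h => h.2⟩
  rw [coe 1 one_ne_zero, coe (-1) (by norm_num), Set.ncard_coe_finset, Set.ncard_coe_finset,
    Finset.card_filter, Finset.card_filter, Finset.sum_filter]
  push_cast
  rw [← Finset.sum_sub_distrib]
  refine Finset.sum_congr rfl fun x _ => ?_
  rcases charge_cases sT lam x with h | h | h <;> by_cases hP : P x <;> simp [h, hP]

variable {n : ℕ}

lemma Ngt_eq (r : ZMod n) (γ : ℤ × Fin l) :
    Ngt n l sT lam r γ =
      chargeSum (fun z => (z.1 : ZMod n) = r ∧ nodeLt γ z) (charge sT lam) := by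
  rw [← ncard_sub_ncard]
  simp only [Ngt, AddableSet, RemovableSet, Set.mem_ofPred_eq, and_assoc]

lemma Nlt_eq (r : ZMod n) (γ : ℤ × Fin l) :
    Nlt n l sT lam r γ =
      chargeSum (fun z => (z.1 : ZMod n) = r ∧ nodeLt z γ) (charge sT lam) := by
  rw [← ncard_sub_ncard]
  simp only [Nlt, AddableSet, RemovableSet, Set.mem_ofPred_eq, and_assoc]

end Charge

lemma sum_charge_mul_zpow {K α ι : Type*} [Field K] [LinearOrder ι] {q : K} (hq : q ≠ 0)
    (g : α → ι) (hg : Function.Injective g) (S : Finset α) (c : α → ℤ)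
    (hc : ∀ x, c x = 0 ∨ c x = 1 ∨ c x = -1) :
    (q - q⁻¹) * ∑ x ∈ S, (c x : K) *
        q ^ ((∑ y ∈ S with g x < g y, c y) - ∑ y ∈ S with g y < g x, c y) =
      q ^ (∑ x ∈ S, c x) - q ^ (-∑ x ∈ S, c x) := by
  classical
  induction S using Finset.induction_on_max_value g with
  | empty => simp
  | insert a s ha hmax ih =>
    have hlt : ∀ x ∈ s, g x < g a := fun x hx =>
      lt_of_le_of_ne (hmax x hx) fun h => ha (hg h ▸ hx)
    rw [Finset.sum_insert ha, Finset.sum_insert ha]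
    have h1 : {y ∈ insert a s | g a < g y} = ∅ := by
      refine Finset.filter_eq_empty_iff.2 fun y hy => ?_
      rcases Finset.mem_insert.1 hy with rfl | hy
      · exact lt_irrefl _
      · exact (hlt y hy).le.not_gt
    have h2 : {y ∈ insert a s | g y < g a} = s := by
      rw [Finset.filter_insert, if_neg (lt_irrefl _), Finset.filter_true_of_mem hlt]
    have h3 : ∑ x ∈ s, (c x : K) * q ^ ((∑ y ∈ insert a s with g x < g y, c y) -
          ∑ y ∈ insert a s with g y < g x, c y) =
        q ^ c a * ∑ x ∈ s, (c x : K) *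
          q ^ ((∑ y ∈ s with g x < g y, c y) - ∑ y ∈ s with g y < g x, c y) := by
      rw [Finset.mul_sum]
      refine Finset.sum_congr rfl fun x hx => ?_
      rw [Finset.filter_insert, if_pos (hlt x hx), Finset.filter_insert,
        if_neg (hlt x hx).not_gt, Finset.sum_insert (by simp [ha]), add_sub_assoc, zpow_add₀ hq]
      ring
    rw [h1, h2, h3, mul_add, mul_left_comm (q - q⁻¹) (q ^ c a), ih, Finset.sum_empty, zero_sub]
    have h4 : (q - q⁻¹) * (c a : K) = q ^ c a - q ^ (-c a) := by
      rcases hc a with h | h | h <;> rw [h] <;> simp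
    rw [← mul_assoc, h4, mul_sub, sub_mul, ← zpow_add₀ hq,
      ← zpow_add₀ hq, ← zpow_add₀ hq, neg_add]
    ring

/-! ### Operators that are locally finite sums of operators attached to sites -/

section SiteSum

variable {n l : ℕ}

/-- `g` is the locally finite sum of the operators `A x` over the sites `x` of colour `r`. -/
def IsSiteSum (r : ZMod n) (A : ℤ × Fin l → Module.End KK (Fock l))
    (g : Module.End KK (Fock l)) : Prop :=
  ∀ v, ∃ S₀ : Finset (ℤ × Fin l), ∀ S, S₀ ⊆ S → g v = ∑ x ∈ S with (x.1 : ZMod n) = r, A x v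

lemma IsSiteSum.of_phi {r : ZMod n} {A : ℤ × Fin l → Module.End KK (Fock l)}
    {g : Module.End KK (Fock l)}
    (h : ∀ lam, ∃ S₀ : Finset (ℤ × Fin l), ∀ S, S₀ ⊆ S →
      g (phi l lam) = ∑ x ∈ S with (x.1 : ZMod n) = r, A x (phi l lam)) : IsSiteSum r A g := by
  classical
  intro v
  induction v using Finsupp.induction_linear with
  | zero => exact ⟨∅, fun S _ => by simp⟩
  | add u v hu hv =>
    obtain ⟨S₁, h₁⟩ := hu
    obtain ⟨S₂, h₂⟩ := hv
    refine ⟨S₁ ∪ S₂, fun S hS => ?_⟩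
    rw [map_add, h₁ S (Finset.union_subset_left hS), h₂ S (Finset.union_subset_right hS),
      ← Finset.sum_add_distrib]
    simp only [map_add]
  | single lam a =>
    obtain ⟨S₀, h₀⟩ := h lam
    refine ⟨S₀, fun S hS => ?_⟩
    have : Finsupp.single lam a = a • phi l lam := by simp [phi]
    rw [this, map_smul, h₀ S hS, Finset.smul_sum]
    simp only [map_smul]

variable {r s : ZMod n} {A B : ℤ × Fin l → Module.End KK (Fock l)}
  {g h T : Module.End KK (Fock l)}

lemma IsSiteSum.exists_mul_eq (hg : IsSiteSum r A g) (hh : IsSiteSum s B h) (v : Fock l) :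
    ∃ S₀ : Finset (ℤ × Fin l), ∀ S, S₀ ⊆ S → g (h v) =
      ∑ x ∈ S with (x.1 : ZMod n) = r, ∑ y ∈ S with (y.1 : ZMod n) = s, A x (B y v) := by
  classical
  obtain ⟨S₁, h₁⟩ := hg (h v)
  obtain ⟨S₂, h₂⟩ := hh v
  refine ⟨S₁ ∪ S₂, fun S hS => ?_⟩
  rw [h₁ S (Finset.union_subset_left hS), h₂ S (Finset.union_subset_right hS)]
  simp only [map_sum]

lemma IsSiteSum.commute (hg : IsSiteSum r A g) (hh : IsSiteSum s B h)
    (hAB : ∀ x y : ℤ × Fin l, (x.1 : ZMod n) = r → (y.1 : ZMod n) = s → A x * B y = B y * A x) :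
    g * h = h * g := by
  classical
  refine LinearMap.ext fun v => ?_
  obtain ⟨S₁, h₁⟩ := hg.exists_mul_eq hh v
  obtain ⟨S₂, h₂⟩ := hh.exists_mul_eq hg v
  rw [Module.End.mul_apply, Module.End.mul_apply, h₁ _ (Finset.subset_union_left (s₂ := S₂)),
    h₂ _ Finset.subset_union_right, Finset.sum_comm]
  refine Finset.sum_congr rfl fun y hy => Finset.sum_congr rfl fun x hx => ?_
  exact LinearMap.congr_fun
    (hAB x y (Finset.mem_filter.1 hx).2 (Finset.mem_filter.1 hy).2) v

lemma IsSiteSum.exists_commutator_eq (hg : IsSiteSum r A g) (hh : IsSiteSum r B h)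
    (hAB : ∀ x y : ℤ × Fin l, x ≠ y → A x * B y = B y * A x) (v : Fock l) :
    ∃ S₀ : Finset (ℤ × Fin l), ∀ S, S₀ ⊆ S → (g * h - h * g) v =
      ∑ x ∈ S with (x.1 : ZMod n) = r, (A x (B x v) - B x (A x v)) := by
  classical
  obtain ⟨S₁, h₁⟩ := hg.exists_mul_eq hh v
  obtain ⟨S₂, h₂⟩ := hh.exists_mul_eq hg v
  refine ⟨S₁ ∪ S₂, fun S hS => ?_⟩
  rw [LinearMap.sub_apply, Module.End.mul_apply, Module.End.mul_apply,
    h₁ _ (Finset.union_subset_left hS), h₂ _ (Finset.union_subset_right hS),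
    Finset.sum_comm (f := fun x y => B x (A y v)), ← Finset.sum_sub_distrib]
  refine Finset.sum_congr rfl fun x hx => ?_
  rw [← Finset.sum_sub_distrib, Finset.sum_eq_single_of_mem x hx]
  intro y _ hyx
  rw [← Module.End.mul_apply, hAB x y hyx.symm, Module.End.mul_apply, sub_self]

lemma IsSiteSum.mul_eq_smul_mul (hg : IsSiteSum r A g) (a : KK)
    (hA : ∀ x : ℤ × Fin l, (x.1 : ZMod n) = r → T * A x = a • (A x * T)) :
    T * g = a • (g * T) := by
  classical
  refine LinearMap.ext fun v => ?_
  obtain ⟨S₁, h₁⟩ := hg v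
  obtain ⟨S₂, h₂⟩ := hg (T v)
  rw [Module.End.mul_apply, LinearMap.smul_apply, Module.End.mul_apply,
    h₁ _ (Finset.subset_union_left (s₂ := S₂)), h₂ _ Finset.subset_union_right, map_sum,
    Finset.smul_sum]
  exact Finset.sum_congr rfl fun x hx => LinearMap.congr_fun (hA x (Finset.mem_filter.1 hx).2) v

end SiteSum

/-! ### Adding and removing a node at a given site -/

section SiteOperators

variable {n l : ℕ}

/-- The total charge of the sites of the colour of `x` lying above `x`. -/
def chargeAbove (n : ℕ) (x : ℤ × Fin l) : ((ℤ × Fin l) →₀ ℤ) →ₗ[ℤ] ℤ :=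
  chargeSum fun z => (z.1 : ZMod n) = (x.1 : ZMod n) ∧ nodeLt x z

/-- The total charge of the sites of the colour of `x` lying below `x`. -/
def chargeBelow (n : ℕ) (x : ℤ × Fin l) : ((ℤ × Fin l) →₀ ℤ) →ₗ[ℤ] ℤ :=
  chargeSum fun z => (z.1 : ZMod n) = (x.1 : ZMod n) ∧ nodeLt z x

/-- The total charge of the sites of colour `r`. -/
def chargeColor (l : ℕ) {n : ℕ} (r : ZMod n) : ((ℤ × Fin l) →₀ ℤ) →ₗ[ℤ] ℤ :=
  chargeSum fun z => (z.1 : ZMod n) = r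

lemma chargeBelow_bump (x y : ℤ × Fin l) :
    chargeBelow n y (bump x) = chargeAbove n x (bump y) := by
  classical
  have h1 : ((siteDown x).1 : ZMod n) = (y.1 : ZMod n) ∧ nodeLt (siteDown x) y ↔
      ((siteUp y).1 : ZMod n) = (x.1 : ZMod n) ∧ nodeLt x (siteUp y) := by
    simp only [siteUp, siteDown, nodeLt, Int.cast_add, Int.cast_sub, Int.cast_one]
    rw [sub_eq_iff_eq_add, eq_comm, show x.1 - 1 < y.1 ↔ x.1 < y.1 + 1 by omega,
      show x.1 - 1 = y.1 ↔ x.1 = y.1 + 1 by omega]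
  have h2 : ((siteUp x).1 : ZMod n) = (y.1 : ZMod n) ∧ nodeLt (siteUp x) y ↔
      ((siteDown y).1 : ZMod n) = (x.1 : ZMod n) ∧ nodeLt x (siteDown y) := by
    simp only [siteUp, siteDown, nodeLt, Int.cast_add, Int.cast_sub, Int.cast_one]
    rw [sub_eq_iff_eq_add, eq_comm, show x.1 + 1 < y.1 ↔ x.1 < y.1 - 1 by omega,
      show x.1 + 1 = y.1 ↔ x.1 = y.1 - 1 by omega]
  have h3 : (x.1 : ZMod n) = (y.1 : ZMod n) ∧ nodeLt x y ↔
      (y.1 : ZMod n) = (x.1 : ZMod n) ∧ nodeLt x y := by rw [eq_comm]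
  simp only [chargeBelow, chargeAbove, bump, map_add, map_sub, chargeSum_single, h1, h2, h3]
  split_ifs <;> rfl

lemma one_ne_zero_zmod (hn : 2 ≤ n) : (1 : ZMod n) ≠ 0 := by
  have : Fact (1 < n) := ⟨hn⟩
  exact one_ne_zero

lemma chargeBelow_bump_self (hn : 2 ≤ n) (x : ℤ × Fin l) : chargeBelow n x (bump x) = 0 := by
  classical
  have h := one_ne_zero_zmod hn
  simp [chargeBelow, bump, chargeSum_single, siteUp, siteDown, h, nodeLt]

lemma chargeColor_bump (r : ZMod n) (x : ℤ × Fin l) :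
    chargeColor l r (bump x) = (if (x.1 : ZMod n) = r + 1 then 1 else 0) +
      (if (x.1 : ZMod n) = r - 1 then 1 else 0) - (if (x.1 : ZMod n) = r then 2 else 0) := by
  classical
  simp only [chargeColor, bump, map_add, map_sub, chargeSum_single, siteUp, siteDown,
    Int.cast_add, Int.cast_sub, Int.cast_one, sub_eq_iff_eq_add, eq_sub_iff_add_eq]

variable (n) (sT : Fin l → ℤ)

open Classical in
/-- The summand of `f_r` adding a node at the site `x`. -/
def addOp (x : ℤ × Fin l) : Module.End KK (Fock l) :=
  Finsupp.linearCombination KK fun lam =>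
    if h : ∃ mu, AddSite sT lam mu x then
      qq ^ chargeAbove n x (charge sT lam) • phi l h.choose else 0

open Classical in
/-- The summand of `e_r` removing a node at the site `x`. -/
def removeOp (x : ℤ × Fin l) : Module.End KK (Fock l) :=
  Finsupp.linearCombination KK fun mu =>
    if h : ∃ lam, AddSite sT lam mu x then
      qq ^ (-chargeBelow n x (charge sT mu)) • phi l h.choose else 0

/-- The operator `t_r`. -/
def weightOp (r : ZMod n) : Module.End KK (Fock l) :=
  Finsupp.linearCombination KK fun lam => qq ^ chargeColor l r (charge sT lam) • phi l lam

/-- The operator `t_r⁻¹`. -/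
def weightInvOp (r : ZMod n) : Module.End KK (Fock l) :=
  Finsupp.linearCombination KK fun lam => qq ^ (-chargeColor l r (charge sT lam)) • phi l lam

variable {n sT} {lam mu : MPtn l} {x y : ℤ × Fin l}

lemma Fock.ext_phi {A B : Module.End KK (Fock l)} (h : ∀ lam, A (phi l lam) = B (phi l lam)) :
    A = B :=
  Finsupp.lhom_ext fun lam a => by
    have : Finsupp.single lam a = a • phi l lam := by simp [phi]
    rw [this, map_smul, map_smul, h]

lemma linearCombination_phi (g : MPtn l → Fock l) :
    Finsupp.linearCombination KK g (phi l lam) = g lam := by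
  simp [phi]

lemma addOp_phi (h : AddSite sT lam mu x) :
    addOp n sT x (phi l lam) = qq ^ chargeAbove n x (charge sT lam) • phi l mu := by
  have hex : ∃ mu, AddSite sT lam mu x := ⟨mu, h⟩
  rw [addOp, linearCombination_phi, dif_pos hex, hex.choose_spec.right_unique h]

lemma addOp_phi_eq_zero (h : ¬ (occ sT lam x = 1 ∧ occ sT lam (siteUp x) = 0)) :
    addOp n sT x (phi l lam) = 0 := by
  have hex : ¬ ∃ mu, AddSite sT lam mu x := fun ⟨_, hmu⟩ => h ⟨hmu.occ_eq.1, hmu.occ_eq.2.1⟩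
  rw [addOp, linearCombination_phi, dif_neg hex]

lemma removeOp_phi (h : AddSite sT lam mu x) :
    removeOp n sT x (phi l mu) = qq ^ (-chargeBelow n x (charge sT mu)) • phi l lam := by
  have hex : ∃ lam, AddSite sT lam mu x := ⟨lam, h⟩
  rw [removeOp, linearCombination_phi, dif_pos hex, hex.choose_spec.left_unique h]

lemma removeOp_phi_eq_zero (h : ¬ (occ sT mu x = 0 ∧ occ sT mu (siteUp x) = 1)) :
    removeOp n sT x (phi l mu) = 0 := by
  have hex : ¬ ∃ lam, AddSite sT lam mu x := fun ⟨_, hlam⟩ => h hlam.occ_right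
  rw [removeOp, linearCombination_phi, dif_neg hex]

lemma weightOp_phi (r : ZMod n) :
    weightOp n sT r (phi l lam) = qq ^ chargeColor l r (charge sT lam) • phi l lam :=
  linearCombination_phi _

lemma weightInvOp_phi (r : ZMod n) :
    weightInvOp n sT r (phi l lam) = qq ^ (-chargeColor l r (charge sT lam)) • phi l lam :=
  linearCombination_phi _

lemma weightOp_mul_weightInvOp (r : ZMod n) : weightOp n sT r * weightInvOp n sT r = 1 :=
  Fock.ext_phi fun lam => by
    rw [Module.End.mul_apply, weightInvOp_phi, map_smul, weightOp_phi, smul_smul,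
      ← zpow_add₀ qq_ne_zero, neg_add_cancel, zpow_zero, one_smul, Module.End.one_apply]

lemma weightInvOp_mul_weightOp (r : ZMod n) : weightInvOp n sT r * weightOp n sT r = 1 :=
  Fock.ext_phi fun lam => by
    rw [Module.End.mul_apply, weightOp_phi, map_smul, weightInvOp_phi, smul_smul,
      ← zpow_add₀ qq_ne_zero, add_neg_cancel, zpow_zero, one_smul, Module.End.one_apply]

lemma weightOp_mul_addOp (r : ZMod n) (x : ℤ × Fin l) :
    weightOp n sT r * addOp n sT x =
      qq ^ chargeColor l r (bump x) • (addOp n sT x * weightOp n sT r) := by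
  refine Fock.ext_phi fun lam => ?_
  rw [LinearMap.smul_apply, Module.End.mul_apply, Module.End.mul_apply, weightOp_phi, map_smul]
  by_cases h : occ sT lam x = 1 ∧ occ sT lam (siteUp x) = 0
  · obtain ⟨mu, hmu⟩ := exists_addSite h.1 h.2
    rw [addOp_phi hmu, map_smul, weightOp_phi, hmu.charge_eq, map_add, zpow_add₀ qq_ne_zero]
    simp only [smul_smul]
    congr 1
    ring
  · rw [addOp_phi_eq_zero h, map_zero, smul_zero, smul_zero]

lemma weightInvOp_mul_removeOp (r : ZMod n) (x : ℤ × Fin l) :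
    weightInvOp n sT r * removeOp n sT x =
      qq ^ chargeColor l r (bump x) • (removeOp n sT x * weightInvOp n sT r) := by
  refine Fock.ext_phi fun mu => ?_
  rw [LinearMap.smul_apply, Module.End.mul_apply, Module.End.mul_apply, weightInvOp_phi, map_smul]
  by_cases h : occ sT mu x = 0 ∧ occ sT mu (siteUp x) = 1
  · obtain ⟨lam, hlam⟩ := exists_addSite_of_removable h.1 h.2
    rw [removeOp_phi hlam, map_smul, weightInvOp_phi, hlam.charge_eq]
    simp only [smul_smul, ← zpow_add₀ qq_ne_zero, map_add]
    congr 2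
    ring
  · rw [removeOp_phi_eq_zero h, map_zero, smul_zero, smul_zero]

lemma removeOp_mul_addOp_of_ne (hxy : x ≠ y) :
    removeOp n sT y * addOp n sT x = addOp n sT x * removeOp n sT y := by
  have hup : siteUp x ≠ siteUp y := siteUp_injective.ne hxy
  refine Fock.ext_phi fun lam => ?_
  rw [Module.End.mul_apply, Module.End.mul_apply]
  by_cases hc : (occ sT lam x = 1 ∧ occ sT lam (siteUp x) = 0) ∧
      (occ sT lam y = 0 ∧ occ sT lam (siteUp y) = 1) ∧ siteUp x ≠ y ∧ x ≠ siteUp y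
  · obtain ⟨hx, hy, hxy₁, hxy₂⟩ := hc
    obtain ⟨mu, hmu⟩ := exists_addSite hx.1 hx.2
    obtain ⟨ka, hka⟩ := exists_addSite_of_removable hy.1 hy.2
    have hmu' := hmu.occ_eq.2.2
    have hka' := hka.occ_eq.2.2
    have hka₁ : occ sT ka x = 1 := by
      have := hka' x
      rw [if_neg hxy.symm, if_neg hxy₂.symm] at this
      omega
    have hka₂ : occ sT ka (siteUp x) = 0 := by
      have := hka' (siteUp x)
      rw [if_neg hxy₁.symm, if_neg hup.symm] at this
      omega
    obtain ⟨nu, hnu⟩ := exists_addSite hka₁ hka₂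
    have hnumu : AddSite sT nu mu y := by
      have hnu' := hnu.occ_eq.2.2
      have hkay := hka.occ_eq
      refine AddSite.of_occ ?_ ?_ fun z => ?_
      · rw [hnu', hkay.1, if_neg hxy, if_neg hxy₁]
        rfl
      · rw [hnu', hkay.2.1, if_neg hxy₂, if_neg hup]
        rfl
      · rw [hmu', hka', hnu']
        ring
    rw [addOp_phi hmu, map_smul, removeOp_phi hnumu, removeOp_phi hka, map_smul, addOp_phi hnu,
      smul_smul, smul_smul, ← zpow_add₀ qq_ne_zero, ← zpow_add₀ qq_ne_zero, hmu.charge_eq,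
      hka.charge_eq]
    simp only [map_add, chargeBelow_bump]
    congr 2
    ring
  · trans (0 : Fock l)
    · by_cases hx : occ sT lam x = 1 ∧ occ sT lam (siteUp x) = 0
      · obtain ⟨mu, hmu⟩ := exists_addSite hx.1 hx.2
        rw [addOp_phi hmu, map_smul, removeOp_phi_eq_zero, smul_zero]
        intro hy
        have hmu' := hmu.occ_eq.2.2
        apply hc
        rw [hmu', hmu', if_neg hxy, if_neg hup] at hy
        obtain ⟨hy₁, hy₂⟩ := hy
        have h₁ : siteUp x ≠ y := by
          rintro rfl
          rw [if_pos rfl] at hy₁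
          omega
        have h₂ : x ≠ siteUp y := by
          intro h
          rw [if_pos h, ← h] at hy₂
          omega
        rw [if_neg h₁] at hy₁
        rw [if_neg h₂] at hy₂
        exact ⟨hx, ⟨by omega, by omega⟩, h₁, h₂⟩
      · rw [addOp_phi_eq_zero hx, map_zero]
    · by_cases hy : occ sT lam y = 0 ∧ occ sT lam (siteUp y) = 1
      · obtain ⟨ka, hka⟩ := exists_addSite_of_removable hy.1 hy.2
        rw [removeOp_phi hka, map_smul, addOp_phi_eq_zero, smul_zero]
        intro hx
        have hka' := hka.occ_eq.2.2
        have hx₁ := hka' x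
        have hx₂ := hka' (siteUp x)
        rw [if_neg hxy.symm, hx.1] at hx₁
        rw [if_neg hup.symm, hx.2] at hx₂
        have hle := occ_eq_zero_or_one sT lam x
        have hle' := occ_eq_zero_or_one sT lam (siteUp x)
        have h₂ : x ≠ siteUp y := by
          intro h
          rw [if_pos h.symm] at hx₁
          omega
        have h₁ : siteUp x ≠ y := by
          intro h
          rw [if_pos h.symm] at hx₂
          omega
        rw [if_neg h₂.symm] at hx₁
        rw [if_neg h₁.symm] at hx₂
        exact hc ⟨⟨by omega, by omega⟩, hy, h₁, h₂⟩
      · rw [removeOp_phi_eq_zero hy, map_zero]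

lemma removeOp_addOp_sub (hn : 2 ≤ n) (x : ℤ × Fin l) :
    removeOp n sT x (addOp n sT x (phi l lam)) - addOp n sT x (removeOp n sT x (phi l lam)) =
      ((charge sT lam x : KK) * qq ^ (chargeAbove n x (charge sT lam) -
        chargeBelow n x (charge sT lam))) • phi l lam := by
  have hself := chargeBelow_bump_self hn x
  have hself' := (chargeBelow_bump (n := n) x x).symm.trans hself
  have had : occ sT lam x = 1 ∧ occ sT lam (siteUp x) = 0 ↔ charge sT lam x = 1 :=
    charge_eq_one_iff.symm
  have hrm : occ sT lam x = 0 ∧ occ sT lam (siteUp x) = 1 ↔ charge sT lam x = -1 :=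
    charge_eq_neg_one_iff.symm
  rcases charge_cases sT lam x with h | h | h
  · rw [addOp_phi_eq_zero (by rw [had, h]; norm_num),
      removeOp_phi_eq_zero (by rw [hrm, h]; norm_num), h]
    simp
  · obtain ⟨mu, hmu⟩ := exists_addSite (had.2 h).1 (had.2 h).2
    rw [addOp_phi hmu, removeOp_phi_eq_zero (by rw [hrm, h]; norm_num), map_smul,
      removeOp_phi hmu, hmu.charge_eq, map_add, hself, h, smul_smul, ← zpow_add₀ qq_ne_zero]
    simp [sub_eq_add_neg]
  · obtain ⟨ka, hka⟩ := exists_addSite_of_removable (hrm.2 h).1 (hrm.2 h).2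
    have habove : chargeAbove n x (charge sT ka) = chargeAbove n x (charge sT lam) := by
      rw [hka.charge_eq, map_add, hself', add_zero]
    rw [addOp_phi_eq_zero (by rw [had, h]; norm_num), removeOp_phi hka, map_smul,
      addOp_phi hka, habove, h, smul_smul, ← zpow_add₀ qq_ne_zero]
    simp [sub_eq_add_neg, add_comm]

lemma sum_removeOp_addOp_sub (hn : 2 ≤ n) (r : ZMod n) (S : Finset (ℤ × Fin l))
    (hS : (charge sT lam).support ⊆ S) :
    (qq - qq⁻¹) • ∑ x ∈ S with (x.1 : ZMod n) = r,
      (removeOp n sT x (addOp n sT x (phi l lam)) - addOp n sT x (removeOp n sT x (phi l lam))) =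
      (weightOp n sT r - weightInvOp n sT r) (phi l lam) := by
  classical
  have hlt : ∀ x y : ℤ × Fin l, nodeLt x y ↔ toLex x < toLex y := fun x y =>
    Prod.Lex.lt_iff.symm
  have key := sum_charge_mul_zpow qq_ne_zero (toLex : ℤ × Fin l → Lex (ℤ × Fin l))
    toLex.injective {x ∈ S | (x.1 : ZMod n) = r} (charge sT lam) (charge_cases sT lam)
  have hcolor : chargeColor l r (charge sT lam) =
      ∑ x ∈ S with (x.1 : ZMod n) = r, charge sT lam x := by
    rw [chargeColor, chargeSum_apply _ _ S hS]
    exact Finset.sum_congr (by ext; simp) fun _ _ => rfl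
  rw [LinearMap.sub_apply, weightOp_phi, weightInvOp_phi, ← sub_smul, hcolor, ← key, mul_smul,
    Finset.sum_smul]
  congr 1
  refine Finset.sum_congr rfl fun x hx => ?_
  have hxr := (Finset.mem_filter.1 hx).2
  rw [removeOp_addOp_sub hn, chargeAbove, chargeBelow, chargeSum_apply _ _ S hS,
    chargeSum_apply _ _ S hS, Finset.filter_filter, Finset.filter_filter]
  simp only [hxr, hlt]

end SiteOperators

/-! ### Local vanishing of iterated `q`-commutators -/

section LocalVanishing

variable {ι : Type*} {c : ι → ℕ} {κ : ι → ℤ}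

lemma apply_mem_supported {A : Module.End KK (ι →₀ KK)} {d : ℕ}
    (hA : ∀ i j, A (Finsupp.single i 1) j ≠ 0 → c j ≤ c i + d) {M : ℕ} {v : ι →₀ KK}
    (hv : v ∈ Finsupp.supported KK KK {i | c i ≤ M}) :
    A v ∈ Finsupp.supported KK KK {i | c i ≤ M + d} := by
  rw [Finsupp.supported_eq_span_single] at hv
  induction hv using Submodule.span_induction with
  | mem x hx =>
    obtain ⟨i, hi, rfl⟩ := hx
    rw [Finsupp.mem_supported]
    intro j hj
    have h1 := hA i j (Finsupp.mem_support_iff.1 hj)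
    have h2 : c i ≤ M := hi
    exact h1.trans (Nat.add_le_add_right h2 d)
  | zero => simp
  | add x y _ _ hx hy => rw [map_add]; exact Submodule.add_mem _ hx hy
  | smul a x _ hx => rw [map_smul]; exact Submodule.smul_mem _ _ hx

lemma diagonal_apply {T : Module.End KK (ι →₀ KK)}
    (hT : ∀ i, T (Finsupp.single i 1) = qq ^ κ i • Finsupp.single i 1) (v : ι →₀ KK) (j : ι) :
    T v j = qq ^ κ j * v j := by
  classical
  induction v using Finsupp.induction_linear with
  | zero => simp
  | add u v hu hv => rw [map_add, Finsupp.add_apply, Finsupp.add_apply, hu, hv, mul_add]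
  | single i a =>
    have : Finsupp.single i a = a • Finsupp.single i (1 : KK) := by simp
    rw [this, map_smul, hT]
    by_cases h : i = j
    · subst h
      simp [mul_comm]
    · simp [h]

/-- Iterated `q`-commutators vanish locally if the weight of a basis vector is bounded by a
complexity `c` which `E` and `F` do not increase and `X` increases by a bounded amount. -/
lemma exists_stable_submodule {E F X T : Module.End KK (ι →₀ KK)} {w : ℤ} {d : ℕ}
    (hκ : ∀ i, |κ i| ≤ c i) (hE : ∀ i j, E (Finsupp.single i 1) j ≠ 0 → c j ≤ c i)
    (hF : ∀ i j, F (Finsupp.single i 1) j ≠ 0 → c j ≤ c i)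
    (hX : ∀ i j, X (Finsupp.single i 1) j ≠ 0 → c j ≤ c i + d)
    (hT : ∀ i, T (Finsupp.single i 1) = qq ^ κ i • Finsupp.single i 1)
    (hTF : T * F = qq ^ (-2 : ℤ) • (F * T)) (hTX : T * X = qq ^ w • (X * T)) (v : ι →₀ KK) :
    ∃ W : Submodule KK (ι →₀ KK), v ∈ W ∧ (∀ u ∈ W, E u ∈ W) ∧ (∀ u ∈ W, T u ∈ W) ∧
      ∃ N₀ : ℕ, ∀ N ≥ N₀, ∀ u ∈ W, serreIter qq F X w N u = 0 := by
  have hiter : ∀ N M : ℕ, ∀ u ∈ Finsupp.supported KK KK {i | c i ≤ M},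
      serreIter qq F X w N u ∈ Finsupp.supported KK KK {i | c i ≤ M + d} := by
    intro N
    induction N with
    | zero => exact fun M u hu => apply_mem_supported hX hu
    | succ N ih =>
      intro M u hu
      have h1 := apply_mem_supported (d := 0) hF (ih M u hu)
      have h2 := ih M _ (apply_mem_supported (d := 0) hF hu)
      exact Submodule.sub_mem _ h1 (Submodule.smul_mem _ _ h2)
  obtain ⟨M, hM⟩ : ∃ M, ∀ i ∈ v.support, c i ≤ M :=
    ⟨v.support.sup c, fun i hi => Finset.le_sup hi⟩
  refine ⟨Finsupp.supported KK KK {i | c i ≤ M}, (Finsupp.mem_supported _ _).2 hM,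
    fun u hu => apply_mem_supported (d := 0) hE hu, fun u hu => ?_,
    (w + 2 * M + d + 1).toNat, fun N hN u hu => ?_⟩
  · refine apply_mem_supported (d := 0) (fun i j h => ?_) hu
    rw [hT] at h
    by_cases hij : i = j
    · simp [hij]
    · simp [hij] at h
  · rw [Finsupp.supported_eq_span_single] at hu
    induction hu using Submodule.span_induction with
    | zero => exact map_zero _
    | add x y _ _ hx hy => rw [map_add, hx, hy, add_zero]
    | smul a x _ hx => rw [map_smul, hx, smul_zero]
    | mem x hx =>
      obtain ⟨i, hi, rfl⟩ := hx
      have hi' : c i ≤ M := hi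
      ext j
      by_contra hj
      rw [Finsupp.zero_apply] at hj
      have hcj : c j ≤ M + d :=
        (Finsupp.mem_supported _ _).1 (hiter N M _ (Finsupp.single_mem_supported KK 1 hi))
          (Finsupp.mem_support_iff.2 hj)
      have h1 := DFunLike.congr_fun (LinearMap.congr_fun (mul_serreIter qq_ne_zero hTF hTX N)
        (Finsupp.single i 1)) j
      rw [Module.End.mul_apply, LinearMap.smul_apply, Module.End.mul_apply, hT, map_smul,
        diagonal_apply hT, Finsupp.smul_apply, Finsupp.smul_apply, smul_eq_mul, smul_eq_mul,
        ← mul_assoc, ← zpow_add₀ qq_ne_zero] at h1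
      have h2 := mul_right_cancel₀ hj h1
      have h3 : κ j = w - 2 * N + κ i := by
        by_contra hne
        refine qq_zpow_ne_one (κ j - (w - 2 * N + κ i)) (sub_ne_zero.2 hne) ?_
        rw [zpow_sub₀ qq_ne_zero, h2, div_self (zpow_ne_zero _ qq_ne_zero)]
      have h4 := abs_le.1 (hκ i)
      have h5 := abs_le.1 (hκ j)
      have h6 := Int.self_le_toNat (w + 2 * M + d + 1)
      omega

end LocalVanishing

/-! ### The Chevalley generators -/

section Chevalley

variable {n l : ℕ} {sT : Fin l → ℤ} {lam mu : MPtn l}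

lemma addOne_iff {r : ZMod n} :
    AddOne n l sT r lam mu ↔ ∃ x, AddSite sT lam mu x ∧ (x.1 : ZMod n) = r := by
  constructor
  · rintro ⟨b, i, h, hr⟩
    exact ⟨(addD sT lam b i, b), ⟨i, h, rfl⟩, hr⟩
  · rintro ⟨x, ⟨i, h, hx⟩, hr⟩
    exact ⟨x.2, i, h, by rw [hx, hr]⟩

lemma AddSite.mem_support_left {x : ℤ × Fin l} (h : AddSite sT lam mu x) :
    x ∈ (charge sT lam).support := by
  rw [Finsupp.mem_support_iff, charge_eq_one_iff.2 ⟨h.occ_eq.1, h.occ_eq.2.1⟩]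
  exact one_ne_zero

lemma AddSite.mem_support_right {x : ℤ × Fin l} (h : AddSite sT lam mu x) :
    x ∈ (charge sT mu).support := by
  rw [Finsupp.mem_support_iff, charge_eq_neg_one_iff.2 h.occ_right]
  norm_num

lemma addOp_phi_apply_eq_zero {x : ℤ × Fin l} (h : ¬ AddSite sT lam mu x) :
    addOp n sT x (phi l lam) mu = 0 := by
  by_cases hx : occ sT lam x = 1 ∧ occ sT lam (siteUp x) = 0
  · obtain ⟨nu, hnu⟩ := exists_addSite hx.1 hx.2
    have hne : nu ≠ mu := fun e => h (e ▸ hnu)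
    rw [addOp_phi hnu, Finsupp.smul_apply, phi, Finsupp.single_eq_of_ne' hne, smul_zero]
  · rw [addOp_phi_eq_zero hx, Finsupp.zero_apply]

lemma removeOp_phi_apply_eq_zero {x : ℤ × Fin l} (h : ¬ AddSite sT lam mu x) :
    removeOp n sT x (phi l mu) lam = 0 := by
  by_cases hx : occ sT mu x = 0 ∧ occ sT mu (siteUp x) = 1
  · obtain ⟨nu, hnu⟩ := exists_addSite_of_removable hx.1 hx.2
    have hne : nu ≠ lam := fun e => h (e ▸ hnu)
    rw [removeOp_phi hnu, Finsupp.smul_apply, phi, Finsupp.single_eq_of_ne' hne, smul_zero]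
  · rw [removeOp_phi_eq_zero hx, Finsupp.zero_apply]

lemma isSiteSum_addOp {f : ZMod n → Module.End KK (Fock l)}
    (hf : ∀ (lam mu : MPtn l) (b : Fin l) (i : ℕ), AddAt lam mu b i →
      f ((addD sT lam b i : ℤ) : ZMod n) (phi l lam) mu =
        qq ^ Ngt n l sT lam ((addD sT lam b i : ℤ) : ZMod n) (addD sT lam b i, b))
    (hf0 : ∀ (r : ZMod n) (lam mu : MPtn l), ¬ AddOne n l sT r lam mu →
      f r (phi l lam) mu = 0) (r : ZMod n) : IsSiteSum r (addOp n sT) (f r) := by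
  refine IsSiteSum.of_phi fun lam => ⟨(charge sT lam).support, fun S hS => ?_⟩
  ext mu
  rw [Finsupp.finsetSum_apply]
  by_cases h : ∃ x, AddSite sT lam mu x ∧ (x.1 : ZMod n) = r
  · obtain ⟨x, hx, rfl⟩ := h
    rw [Finset.sum_eq_single_of_mem (s := S.filter fun y => (y.1 : ZMod n) = (x.1 : ZMod n)) x
      (Finset.mem_filter.2 ⟨hS hx.mem_support_left, rfl⟩)
      fun y _ hyx => addOp_phi_apply_eq_zero fun hy => hyx (hy.site_unique hx), addOp_phi hx]
    obtain ⟨i, hi, hd⟩ := hx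
    have := hf lam mu x.2 i hi
    rw [hd, Ngt_eq] at this
    rw [this]
    simp [phi, chargeAbove]
  · rw [hf0 r lam mu (addOne_iff.not.2 h)]
    exact (Finset.sum_eq_zero fun x hx => addOp_phi_apply_eq_zero fun hs =>
      h ⟨x, hs, (Finset.mem_filter.1 hx).2⟩).symm

lemma isSiteSum_removeOp (hn : 2 ≤ n) {e : ZMod n → Module.End KK (Fock l)}
    (he : ∀ (lam mu : MPtn l) (b : Fin l) (i : ℕ), AddAt lam mu b i →
      e ((addD sT lam b i : ℤ) : ZMod n) (phi l mu) lam =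
        qq ^ (- Nlt n l sT lam ((addD sT lam b i : ℤ) : ZMod n) (addD sT lam b i, b)))
    (he0 : ∀ (r : ZMod n) (lam mu : MPtn l), ¬ AddOne n l sT r lam mu →
      e r (phi l mu) lam = 0) (r : ZMod n) : IsSiteSum r (removeOp n sT) (e r) := by
  refine IsSiteSum.of_phi fun mu => ⟨(charge sT mu).support, fun S hS => ?_⟩
  ext lam
  rw [Finsupp.finsetSum_apply]
  by_cases h : ∃ x, AddSite sT lam mu x ∧ (x.1 : ZMod n) = r
  · obtain ⟨x, hx, rfl⟩ := h
    rw [Finset.sum_eq_single_of_mem (s := S.filter fun y => (y.1 : ZMod n) = (x.1 : ZMod n)) x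
      (Finset.mem_filter.2 ⟨hS hx.mem_support_right, rfl⟩)
      fun y _ hyx => removeOp_phi_apply_eq_zero fun hy => hyx (hy.site_unique hx),
      removeOp_phi hx, hx.charge_eq, map_add, chargeBelow_bump_self hn]
    obtain ⟨i, hi, hd⟩ := hx
    have := he lam mu x.2 i hi
    rw [hd, Nlt_eq] at this
    rw [this]
    simp [phi, chargeBelow]
  · rw [he0 r lam mu (addOne_iff.not.2 h)]
    exact (Finset.sum_eq_zero fun x hx => removeOp_phi_apply_eq_zero fun hs =>
      h ⟨x, hs, (Finset.mem_filter.1 hx).2⟩).symm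

variable {r s : ZMod n} {g h : Module.End KK (Fock l)}

lemma chevalley_commutator (hn : 2 ≤ n) (hg : IsSiteSum r (removeOp n sT) g)
    (hh : IsSiteSum r (addOp n sT) h) :
    (qq - qq⁻¹) • (g * h - h * g) = weightOp n sT r - weightInvOp n sT r := by
  classical
  refine Fock.ext_phi fun lam => ?_
  obtain ⟨S₀, h₀⟩ := hg.exists_commutator_eq hh
    (fun x y hxy => removeOp_mul_addOp_of_ne hxy.symm) (phi l lam)
  rw [LinearMap.smul_apply, h₀ _ (Finset.subset_union_left (s₂ := (charge sT lam).support)),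
    sum_removeOp_addOp_sub hn r _ Finset.subset_union_right]

lemma chevalley_commute (hrs : r ≠ s) (hg : IsSiteSum r (removeOp n sT) g)
    (hh : IsSiteSum s (addOp n sT) h) : g * h = h * g :=
  hg.commute hh fun x y hx hy => removeOp_mul_addOp_of_ne fun hxy => hrs (by rw [← hx, ← hy, hxy])

lemma chargeColor_bump_self (hn : 2 ≤ n) {x : ℤ × Fin l} (hx : (x.1 : ZMod n) = r) :
    chargeColor l r (bump x) = -2 := by
  have h := one_ne_zero_zmod hn
  rw [chargeColor_bump, hx]
  simp [h, eq_sub_iff_add_eq]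

lemma chargeColor_bump_of_ne (hrs : r ≠ s) {x : ℤ × Fin l} (hx : (x.1 : ZMod n) = s) :
    chargeColor l r (bump x) =
      (if s = r + 1 then 1 else 0) + (if s = r - 1 then 1 else 0) := by
  rw [chargeColor_bump, hx, if_neg hrs.symm, sub_zero]

/-- The number of addable and removable `r`-nodes of `lam`. -/
def colorCard {l n : ℕ} (sT : Fin l → ℤ) (r : ZMod n) (lam : MPtn l) : ℕ :=
  ((charge sT lam).support.filter fun x => (x.1 : ZMod n) = r).card

lemma abs_chargeColor_le (r : ZMod n) (lam : MPtn l) :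
    |chargeColor l r (charge sT lam)| ≤ colorCard sT r lam := by
  classical
  rw [chargeColor, chargeSum_apply _ _ _ subset_rfl, colorCard, Finset.card_eq_sum_ones,
    Nat.cast_sum]
  refine (Finset.abs_sum_le_sum_abs _ _).trans (le_of_eq ?_)
  refine Finset.sum_congr (by ext; simp) fun x hx => ?_
  have := Finsupp.mem_support_iff.1 (Finset.mem_filter.1 hx).1
  rcases charge_cases sT lam x with h | h | h <;> simp_all

lemma AddSite.colorCard_eq (hn : 2 ≤ n) {x : ℤ × Fin l} (h : AddSite sT lam mu x)
    (hx : (x.1 : ZMod n) = r) : colorCard sT r mu = colorCard sT r lam := by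
  classical
  have h1 := one_ne_zero_zmod hn
  rw [colorCard, colorCard]
  congr 1
  ext z
  simp only [Finset.mem_filter]
  refine and_congr_left fun hz => ?_
  by_cases hzx : z = x
  · subst hzx
    exact iff_of_true h.mem_support_right h.mem_support_left
  · have hd : siteDown x ≠ z := by
      rintro rfl
      rw [← hx] at hz
      simp [siteDown, h1] at hz
    have hu : siteUp x ≠ z := by
      rintro rfl
      rw [← hx] at hz
      simp [siteUp, h1] at hz
    rw [Finsupp.mem_support_iff, Finsupp.mem_support_iff, h.charge_eq]
    simp [bump, hd, hu, Ne.symm hzx]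

lemma colorCard_le_add_three {x : ℤ × Fin l}
    (h : ∀ z, z ≠ siteDown x → z ≠ siteUp x → z ≠ x → charge sT mu z = charge sT lam z) :
    colorCard sT r mu ≤ colorCard sT r lam + 3 := by
  classical
  have hsub : ((charge sT mu).support.filter fun x => (x.1 : ZMod n) = r) ⊆
      ((charge sT lam).support.filter fun x => (x.1 : ZMod n) = r) ∪
        {siteDown x, siteUp x, x} := by
    intro z hz
    rw [Finset.mem_filter, Finsupp.mem_support_iff] at hz
    simp only [Finset.mem_union, Finset.mem_filter, Finsupp.mem_support_iff, Finset.mem_insert,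
      Finset.mem_singleton]
    by_contra! hc
    obtain ⟨hc, hd, hu, hx⟩ := hc
    rw [h z hd hu hx] at hz
    exact hc hz.1 hz.2
  exact (Finset.card_le_card hsub).trans ((Finset.card_union_le _ _).trans
    (Nat.add_le_add_left Finset.card_le_three _))

lemma AddSite.charge_apply_of_ne {x z : ℤ × Fin l} (h : AddSite sT lam mu x)
    (hd : z ≠ siteDown x) (hu : z ≠ siteUp x) (hx : z ≠ x) :
    charge sT mu z = charge sT lam z := by
  rw [h.charge_eq]
  simp [bump, hd, hu, hx]

lemma AddOne.colorCard_eq (hn : 2 ≤ n) (h : AddOne n l sT r lam mu) :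
    colorCard sT r mu = colorCard sT r lam := by
  obtain ⟨x, hx, hr⟩ := addOne_iff.1 h
  exact hx.colorCard_eq hn hr

lemma AddOne.colorCard_le_add_three (h : AddOne n l sT s lam mu) :
    colorCard sT r mu ≤ colorCard sT r lam + 3 ∧
      colorCard sT r lam ≤ colorCard sT r mu + 3 := by
  obtain ⟨x, hx, -⟩ := addOne_iff.1 h
  exact ⟨_root_.colorCard_le_add_three fun z hd hu hz => hx.charge_apply_of_ne hd hu hz,
    _root_.colorCard_le_add_three fun z hd hu hz => (hx.charge_apply_of_ne hd hu hz).symm⟩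

end Chevalley

/-- the quantum Serre relations hold on the Fock space. -/
theorem stmt_6 (n l : ℕ) (hn : 2 ≤ n) (hl : 1 ≤ l) (sT : Fin l → ℤ)
    (e f : ZMod n → Module.End KK (Fock l))
    (hf : ∀ (lam mu : MPtn l) (b : Fin l) (i : ℕ), AddAt lam mu b i →
      f ((addD sT lam b i : ℤ) : ZMod n) (phi l lam) mu =
        qq ^ Ngt n l sT lam ((addD sT lam b i : ℤ) : ZMod n) (addD sT lam b i, b))
    (hf0 : ∀ (r : ZMod n) (lam mu : MPtn l), ¬ AddOne n l sT r lam mu →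
      f r (phi l lam) mu = 0)
    (he : ∀ (lam mu : MPtn l) (b : Fin l) (i : ℕ), AddAt lam mu b i →
      e ((addD sT lam b i : ℤ) : ZMod n) (phi l mu) lam =
        qq ^ (- Nlt n l sT lam ((addD sT lam b i : ℤ) : ZMod n) (addD sT lam b i, b)))
    (he0 : ∀ (r : ZMod n) (lam mu : MPtn l), ¬ AddOne n l sT r lam mu →
      e r (phi l mu) lam = 0) :
    ∀ r s : ZMod n, r ≠ s →
      ∀ m : ℕ, m = 1 + (if s = r + 1 then 1 else 0) + (if s = r - 1 then 1 else 0) →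
      (∑ k ∈ Finset.range (m + 1),
        ((-1 : KK) ^ k * qBinom m k) • (e r ^ k * e s * e r ^ (m - k)) = 0) ∧
      (∑ k ∈ Finset.range (m + 1),
        ((-1 : KK) ^ k * qBinom m k) • (f r ^ k * f s * f r ^ (m - k)) = 0) := by
  intro r s hrs m hm
  have hF := isSiteSum_addOp hf hf0
  have hE := isSiteSum_removeOp hn he he0
  have hcomm := chevalley_commutator hn (hE r) (hF r)
  have hcomm_neg : (qq - qq⁻¹) • (f r * e r - e r * f r) =
      weightInvOp n sT r - weightOp n sT r := by
    rw [← neg_sub (e r * f r), smul_neg, hcomm]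
    exact neg_sub (weightOp n sT r) (weightInvOp n sT r)
  have hw : (if s = r + 1 then (1 : ℤ) else 0) + (if s = r - 1 then 1 else 0) = (m : ℤ) - 1 := by
    rw [hm]
    push_cast
    ring
  have hm₁ : 1 ≤ m := by omega
  have hm₃ : m ≤ 3 := by
    rw [hm]
    split_ifs <;> omega
  have hf_supp : ∀ (p : ZMod n) (i j : MPtn l), f p (phi l i) j ≠ 0 → AddOne n l sT p i j :=
    fun p i j h => by_contra fun hc => h (hf0 p i j hc)
  have he_supp : ∀ (p : ZMod n) (i j : MPtn l), e p (phi l i) j ≠ 0 → AddOne n l sT p j i :=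
    fun p i j h => by_contra fun hc => h (he0 p j i hc)
  have hTF : weightOp n sT r * f r = qq ^ (-2 : ℤ) • (f r * weightOp n sT r) :=
    (hF r).mul_eq_smul_mul _ fun x hx => by rw [weightOp_mul_addOp, chargeColor_bump_self hn hx]
  have hTX : weightOp n sT r * f s = qq ^ ((m : ℤ) - 1) • (f s * weightOp n sT r) :=
    (hF s).mul_eq_smul_mul _ fun x hx => by
      rw [weightOp_mul_addOp, chargeColor_bump_of_ne hrs hx, hw]
  have hTF' : weightInvOp n sT r * e r = qq ^ (-2 : ℤ) • (e r * weightInvOp n sT r) :=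
    (hE r).mul_eq_smul_mul _ fun x hx => by
      rw [weightInvOp_mul_removeOp, chargeColor_bump_self hn hx]
  have hTX' : weightInvOp n sT r * e s = qq ^ ((m : ℤ) - 1) • (e s * weightInvOp n sT r) :=
    (hE s).mul_eq_smul_mul _ fun x hx => by
      rw [weightInvOp_mul_removeOp, chargeColor_bump_of_ne hrs hx, hw]
  rw [sum_qBinom_eq_serreIter _ _ m hm₁ hm₃, sum_qBinom_eq_serreIter _ _ m hm₁ hm₃]
  constructor
  · rw [serreIter_eq_zero qq_ne_zero qq_zpow_ne_one (weightInvOp_mul_weightOp r)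
      (weightOp_mul_weightInvOp r) hcomm_neg
      (chevalley_commute hrs.symm (hE s) (hF r)).symm hTF' hTX'
      (exists_stable_submodule (c := colorCard sT r) (d := 3)
        (fun lam => (abs_neg _).trans_le (abs_chargeColor_le r lam))
        (fun i j h => ((hf_supp r i j h).colorCard_eq hn).le)
        (fun i j h => ((he_supp r i j h).colorCard_eq hn).ge)
        (fun i j h => (he_supp s i j h).colorCard_le_add_three.2)
        (fun lam => weightInvOp_phi r) hTF' hTX') m (by omega), smul_zero]
  · rw [serreIter_eq_zero qq_ne_zero qq_zpow_ne_one (weightOp_mul_weightInvOp r)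
      (weightInvOp_mul_weightOp r) hcomm (chevalley_commute hrs (hE r) (hF s)) hTF hTX
      (exists_stable_submodule (c := colorCard sT r) (d := 3) (abs_chargeColor_le r)
        (fun i j h => ((he_supp r i j h).colorCard_eq hn).ge)
        (fun i j h => ((hf_supp r i j h).colorCard_eq hn).le)
        (fun i j h => (hf_supp s i j h).colorCard_le_add_three.1)
        (fun lam => weightOp_phi r) hTF hTX) m (by omega), smul_zero]
end
end

section
/- For every l-multipartition λ_l with charge s_l and every r ∈ ℤ/nℤ, N_r(λ_l) = #{b ∈ {1,…,l} : s_b ≡ r (mod n)} − 2·c_r(λ_l) + c_{r+1}(λ_l) + c_{r−1}(λ_l), where c_i(λ_l) denotes the number of nodes of λ_l of color i and the indices r ± 1 are taken mod n (so that for n = 2 the last two terms both equal c_{r+1}(λ_l)). -/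
/-!
Shared setup for the level-`l` q-deformed Fock space of `U_q'(sl_n^)` with charge
`sT = (s_1, …, s_l)` (here `sT b` is the paper's `s_{b+1}`; rows and columns of
partitions are 0-indexed, so the node `(i, j, b)` of the paper is `(b, i-1, j-1)`).

* `Ptn` : partitions; `MPtn l` : `l`-multipartitions.
* `addableRow lam b i` : a node can be added to `lam` in component `b`, row `i`;
  the added node then lies in column `(lam b).1 i` and has `d`-value
  `addD sT lam b i = sT b + (lam b).1 i - i` and colour `(addD … : ZMod n)`.
* `removableRow lam b i` : a node can be removed in component `b`, row `i`;
  it has `d`-value `remD sT lam b i = sT b + (lam b).1 i - 1 - i`.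
* `nodeLt` : the total order `(d, b) < (d', b')` on nodes.
* `AddableSet/RemovableSet n l sT lam r` : positions of addable/removable
  `r`-nodes; `Nr` is `N_r(λ)`, and `Ngt/Nlt n l sT lam r γ` are
  `N_r^>(λ,μ)/N_r^<(λ,μ)` for the added node `γ = (d, b)`.
* `AddAt lam mu b i` : `mu` is obtained from `lam` by adding one node in component
  `b`, row `i`; `AddOne n l sT r lam mu` is the relation `μ/λ = r`.
* `Fock l = (MPtn l) →₀ ℚ(q)` with natural basis `phi l lam`; the operators
  `e r, f r, t r, t r ^{-1}` are characterized by their matrix entries in this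
  basis (hypotheses of the theorems below).
-/

noncomputable section

/-- `c_r(λ_l)`: the number of nodes of `λ_l` of colour `r` (a node is `(b, i, j)`
with 0-indexed row `i`, column `j < (λ^{(b)})_i`, of colour `s_b + j - i mod n`). -/
noncomputable def colorCount (n l : ℕ) (sT : Fin l → ℤ) (lam : MPtn l) (r : ZMod n) :
    ℤ :=
  (({x : Fin l × ℕ × ℕ | x.2.2 < (lam x.1).1 x.2.1 ∧
      ((sT x.1 + x.2.2 - x.2.1 : ℤ) : ZMod n) = r}).ncard : ℤ)

open Finset in
open scoped Classical in
theorem ncard_setOf_prod_eq_sum {α β : Type*} [Fintype α] (P : α → β → Prop)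
    (T : α → Finset β) (h : ∀ a x, P a x → x ∈ T a) :
    ((({p : α × β | P p.1 p.2}).ncard : ℕ) : ℤ) =
      ∑ a, ∑ x ∈ T a, if P a x then (1 : ℤ) else 0 := by
  have hS : {p : α × β | P p.1 p.2} =
      ↑((((univ : Finset α).sigma fun a => (T a).filter (P a)).map
        (Equiv.sigmaEquivProd α β).toEmbedding) : Finset (α × β)) := by
    ext ⟨a, x⟩
    simp only [Set.mem_ofPred_eq, coe_map, Equiv.coe_toEmbedding, Set.mem_image, mem_coe,
      mem_sigma, mem_univ, true_and, mem_filter]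
    constructor
    · exact fun hx => ⟨⟨a, x⟩, ⟨h a x hx, hx⟩, rfl⟩
    · rintro ⟨⟨c, y⟩, ⟨-, hx⟩, he⟩
      cases he
      exact hx
  rw [hS, Set.ncard_coe_finset, card_map, card_sigma]
  push_cast
  simp

/-- `ite_and` for an arbitrary decidability instance on the conjunction. -/
theorem ite_and_of_decidable {α : Sort*} (P Q : Prop) [Decidable (P ∧ Q)] [Decidable P]
    [Decidable Q] (a b : α) :
    (if P ∧ Q then a else b) = if P then if Q then a else b else b := by
  by_cases hP : P <;> by_cases hQ : Q <;> simp [hP, hQ]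

open Finset in
theorem sum_range_second_difference (χ : ℤ → ℤ) (x : ℤ) (m : ℕ) :
    ∑ j ∈ range m, (χ (x + j + 1) - 2 * χ (x + j) + χ (x + j - 1)) =
      χ (x + m) - χ (x + m - 1) - χ x + χ (x - 1) := by
  induction m with
  | zero => simp
  | succ m ih =>
    rw [sum_range_succ, ih]
    push_cast
    rw [← add_assoc x (m : ℤ) 1, add_sub_cancel_right]
    ring

open Finset in
open scoped Classical in
/-- Rows that are not addable cancel against the preceding rows, which are not removable. -/
theorem sum_addableRow_sub_sum_removableRow {l : ℕ} (χ : ℤ → ℤ) (sT : Fin l → ℤ)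
    (lam : MPtn l) (b : Fin l) (N : ℕ) :
    (∑ i ∈ range (N + 1), if addableRow lam b i then χ (addD sT lam b i) else 0) -
        (∑ i ∈ range N, if removableRow lam b i then χ (remD sT lam b i) else 0) =
      ∑ i ∈ range (N + 1), χ (addD sT lam b i) - ∑ i ∈ range N, χ (remD sT lam b i) := by
  induction N with
  | zero => simp [addableRow]
  | succ N ih =>
    simp only [sum_range_succ] at ih ⊢
    have hiff : addableRow lam b (N + 1) ↔ removableRow lam b N := by
      simp [addableRow, removableRow]
    by_cases hr : removableRow lam b N
    · rw [if_pos (hiff.2 hr), if_pos hr]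
      linarith
    · rw [if_neg (mt hiff.1 hr), if_neg hr]
      have heq : (lam b).1 (N + 1) = (lam b).1 N :=
        le_antisymm ((lam b).2.1 (Nat.le_succ N)) (not_lt.1 hr)
      have hd : addD sT lam b (N + 1) = remD sT lam b N := by
        simp only [addD, remD, heq]
        push_cast
        ring
      rw [hd]
      linarith

open Finset in
open scoped Classical in
theorem colorCount_eq_sum (n l : ℕ) (sT : Fin l → ℤ) (lam : MPtn l) (r : ZMod n)
    (N : Fin l → ℕ) (hN : ∀ b, ∀ i ≥ N b, (lam b).1 i = 0) :
    colorCount n l sT lam r = ∑ b, ∑ i ∈ range (N b), ∑ j ∈ range ((lam b).1 i),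
      if ((sT b - i + j : ℤ) : ZMod n) = r then (1 : ℤ) else 0 := by
  have hcard := ncard_setOf_prod_eq_sum
    (fun (b : Fin l) (x : ℕ × ℕ) => x.2 < (lam b).1 x.1 ∧
      ((sT b + x.2 - x.1 : ℤ) : ZMod n) = r)
    (fun b => range (N b) ×ˢ range ((lam b).1 0)) (by
      rintro b ⟨i, j⟩ ⟨hj, -⟩
      simp only [mem_product, mem_range]
      refine ⟨?_, hj.trans_le ((lam b).2.1 (Nat.zero_le i))⟩
      by_contra hi
      exact absurd hj (by simp [hN b i (not_lt.1 hi)]))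
  rw [colorCount, hcard]
  refine sum_congr rfl fun b _ => ?_
  rw [sum_product]
  refine sum_congr rfl fun i _ => ?_
  have hrange : range ((lam b).1 i) = (range ((lam b).1 0)).filter (· < (lam b).1 i) := by
    ext j
    have := (lam b).2.1 (Nat.zero_le i)
    simp only [mem_range, mem_filter]
    omega
  rw [hrange, sum_filter]
  refine sum_congr rfl fun j _ => ?_
  simp only [add_sub_right_comm, ite_and_of_decidable]

open Finset in
open scoped Classical in
theorem Nr_eq_sum (n l : ℕ) (sT : Fin l → ℤ) (lam : MPtn l) (r : ZMod n)
    (N : Fin l → ℕ) (hN : ∀ b, ∀ i ≥ N b, (lam b).1 i = 0) :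
    Nr n l sT lam r = ∑ b,
      ((∑ i ∈ range (N b + 1), if ((addD sT lam b i : ℤ) : ZMod n) = r then (1 : ℤ) else 0) -
        ∑ i ∈ range (N b), if ((remD sT lam b i : ℤ) : ZMod n) = r then (1 : ℤ) else 0) := by
  have hadd := ncard_setOf_prod_eq_sum
    (fun (b : Fin l) (i : ℕ) => addableRow lam b i ∧ ((addD sT lam b i : ℤ) : ZMod n) = r)
    (fun b => range (N b + 1)) (by
      rintro b i ⟨hi, -⟩
      rw [mem_range]
      by_contra hlt
      rcases hi with hi | hi
      · omega
      · rw [hN b (i - 1) (by omega)] at hi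
        omega)
  have hrem := ncard_setOf_prod_eq_sum
    (fun (b : Fin l) (i : ℕ) => removableRow lam b i ∧ ((remD sT lam b i : ℤ) : ZMod n) = r)
    (fun b => range (N b)) (by
      rintro b i ⟨hi, -⟩
      rw [mem_range]
      by_contra hlt
      rw [removableRow, hN b i (not_lt.1 hlt)] at hi
      omega)
  rw [Nr, AddableSet, RemovableSet, hadd, hrem, ← sum_sub_distrib]
  refine sum_congr rfl fun b _ => ?_
  simp only [ite_and_of_decidable]
  exact sum_addableRow_sub_sum_removableRow
    (fun x : ℤ => if (x : ZMod n) = r then (1 : ℤ) else 0) sT lam b (N b)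

/-- `N_r(λ_l) = #{b : s_b ≡ r mod n} - 2 c_r(λ_l) + c_{r+1}(λ_l) + c_{r-1}(λ_l)`. -/
theorem stmt_8 (n l : ℕ) (hn : 2 ≤ n) (hl : 1 ≤ l) (sT : Fin l → ℤ)
    (lam : MPtn l) (r : ZMod n) :
    Nr n l sT lam r =
      ((Finset.univ.filter (fun b : Fin l => ((sT b : ZMod n) = r))).card : ℤ)
        - 2 * colorCount n l sT lam r
        + colorCount n l sT lam (r + 1) + colorCount n l sT lam (r - 1) := by
  classical
  choose N hN using fun b => (lam b).2.2
  set χ : ℤ → ℤ := fun x => if (x : ZMod n) = r then 1 else 0 with hχ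
  have hup (x : ℤ) : (if (x : ZMod n) = r + 1 then (1 : ℤ) else 0) = χ (x - 1) := by
    simp [hχ, sub_eq_iff_eq_add]
  have hdown (x : ℤ) : (if (x : ZMod n) = r - 1 then (1 : ℤ) else 0) = χ (x + 1) := by
    simp [hχ, eq_sub_iff_add_eq]
  have hself (x : ℤ) : (if (x : ZMod n) = r then (1 : ℤ) else 0) = χ x := rfl
  have hcharge : ((Finset.univ.filter (fun b : Fin l => ((sT b : ZMod n) = r))).card : ℤ) =
      ∑ b, χ (sT b) := by
    simp [hχ]
  rw [hcharge, Nr_eq_sum n l sT lam r N hN]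
  simp only [colorCount_eq_sum n l sT lam _ N hN, hup, hdown, hself]
  rw [Finset.mul_sum, ← Finset.sum_sub_distrib, ← Finset.sum_add_distrib,
    ← Finset.sum_add_distrib]
  refine Finset.sum_congr rfl fun b _ => ?_
  have hrow (i : ℕ) := sum_range_second_difference χ (sT b - i) ((lam b).1 i)
  have hsum := Finset.sum_congr (rfl : Finset.range (N b) = _) fun i _ => hrow i
  have htel := Finset.sum_range_sub (fun i : ℕ => χ (sT b - i)) (N b)
  have hstep (i : ℕ) : sT b - ((i + 1 : ℕ) : ℤ) = sT b - i - 1 := by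
    push_cast
    ring
  have hadd (i : ℕ) : addD sT lam b i = sT b - i + (lam b).1 i := by
    simp only [addD]
    ring
  have hrem (i : ℕ) : remD sT lam b i = sT b - i + (lam b).1 i - 1 := by
    simp only [remD]
    ring
  simp only [hstep, Finset.sum_sub_distrib, Nat.cast_zero, sub_zero] at htel
  simp only [Finset.sum_add_distrib, Finset.sum_sub_distrib, ← Finset.mul_sum] at hsum
  simp only [hadd, hrem]
  rw [Finset.sum_range_succ, hN b (N b) le_rfl, Nat.cast_zero, add_zero]
  linarith
end
end

section
/- Each of the 3n operators t_i^{(n)}, e_i^{(n)}, f_i^{(n)} (0 ≤ i ≤ n−1) on V commutes with each of the 3l operators t_j^{(l)}, e_j^{(l)}, f_j^{(l)} (0 ≤ j ≤ l−1); i.e., the actions of U_q′(ŝl_n) and U_q′(ŝl_l) on V commute with one another. -/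
/-!
Shared setup for the `U_q'(sl_n^) × U_q'(sl_l^)`-module
`V = (V_n ⊗ V_l)[z, z⁻¹]` (fix `n > 1`, `l > 1`).

`V` has basis `w(a, b, m)` with `a ∈ {1,…,n}`, `b ∈ {1,…,l}`, `m ∈ ℤ`; we encode
the cyclic index `a` as an element of `ZMod n` (with `n ↔ 0`, so the conventions
`w(0,b,m) = w(n,b,m)` and `w(n+1,b,m) = w(1,b,m)` are automatic) and likewise `b`
as an element of `ZMod l`.  The generator index `i ∈ {0,…,n-1}` is also encoded in
`ZMod n`, so that `δ(i ≡ a mod n)` becomes `a = i` and `δ(i+1 ≡ a mod n)` becomes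
`a = i+1`.  The operators are:

* `tN i w(a,b,m) = q^{δ(a=i) - δ(a=i+1)} w(a,b,m)` (and `tNinv` its inverse),
* `eN i w(a,b,m) = δ(a = i+1) w(a-1, b, m + δ(i=0))`,
* `fN i w(a,b,m) = δ(a = i) w(a+1, b, m - δ(i=0))`,

and `tL, tLinv, eL, fL` are the same formulas with the roles of `(n, a)` and
`(l, b)` exchanged.
-/

noncomputable section

/-- index set of the basis of `V`. -/
abbrev BIdx (n l : ℕ) : Type := ZMod n × ZMod l × ℤ

abbrev VV (n l : ℕ) : Type := BIdx n l →₀ KK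

/-- the basis vector `w(a, b, m)`. -/
noncomputable def wB (n l : ℕ) (x : BIdx n l) : VV n l := Finsupp.single x 1

/-- the linear operator sending each basis vector `w(x)` to `g x`. -/
noncomputable def opOf (n l : ℕ) (g : BIdx n l → VV n l) : Module.End KK (VV n l) :=
  Finsupp.lsum KK fun x => LinearMap.toSpanSingleton KK (VV n l) (g x)

noncomputable def tN (n l : ℕ) (i : ZMod n) : Module.End KK (VV n l) :=
  opOf n l fun x =>
    qq ^ (((if x.1 = i then 1 else 0) - (if x.1 = i + 1 then 1 else 0) : ℤ)) • wB n l x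

noncomputable def tNinv (n l : ℕ) (i : ZMod n) : Module.End KK (VV n l) :=
  opOf n l fun x =>
    qq ^ (-((if x.1 = i then 1 else 0) - (if x.1 = i + 1 then 1 else 0) : ℤ)) • wB n l x

noncomputable def eN (n l : ℕ) (i : ZMod n) : Module.End KK (VV n l) :=
  opOf n l fun x =>
    if x.1 = i + 1 then
      wB n l (x.1 - 1, x.2.1, x.2.2 + (if i = 0 then 1 else 0)) else 0

noncomputable def fN (n l : ℕ) (i : ZMod n) : Module.End KK (VV n l) :=
  opOf n l fun x =>
    if x.1 = i then
      wB n l (x.1 + 1, x.2.1, x.2.2 - (if i = 0 then 1 else 0)) else 0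

noncomputable def tL (n l : ℕ) (j : ZMod l) : Module.End KK (VV n l) :=
  opOf n l fun x =>
    qq ^ (((if x.2.1 = j then 1 else 0) - (if x.2.1 = j + 1 then 1 else 0) : ℤ)) • wB n l x

noncomputable def tLinv (n l : ℕ) (j : ZMod l) : Module.End KK (VV n l) :=
  opOf n l fun x =>
    qq ^ (-((if x.2.1 = j then 1 else 0) - (if x.2.1 = j + 1 then 1 else 0) : ℤ)) • wB n l x

noncomputable def eL (n l : ℕ) (j : ZMod l) : Module.End KK (VV n l) :=
  opOf n l fun x =>
    if x.2.1 = j + 1 then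
      wB n l (x.1, x.2.1 - 1, x.2.2 + (if j = 0 then 1 else 0)) else 0

noncomputable def fL (n l : ℕ) (j : ZMod l) : Module.End KK (VV n l) :=
  opOf n l fun x =>
    if x.2.1 = j then
      wB n l (x.1, x.2.1 + 1, x.2.2 - (if j = 0 then 1 else 0)) else 0

theorem opOf_wB (n l : ℕ) (g : BIdx n l → VV n l) (x : BIdx n l) :
    opOf n l g (wB n l x) = g x := by
  simp [opOf, wB]

/-- The operator `w(a, b, m) ↦ c(a) w(a + s, b, m + d)`. -/
def weightedShiftN (n l : ℕ) (c : ZMod n → KK) (s : ZMod n) (d : ℤ) : Module.End KK (VV n l) :=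
  opOf n l fun x => c x.1 • wB n l (x.1 + s, x.2.1, x.2.2 + d)

/-- The operator `w(a, b, m) ↦ c(b) w(a, b + s, m + d)`. -/
def weightedShiftL (n l : ℕ) (c : ZMod l → KK) (s : ZMod l) (d : ℤ) : Module.End KK (VV n l) :=
  opOf n l fun x => c x.2.1 • wB n l (x.1, x.2.1 + s, x.2.2 + d)

theorem commute_weightedShift {n l : ℕ} (c : ZMod n → KK) (s : ZMod n) (d : ℤ)
    (c' : ZMod l → KK) (s' : ZMod l) (d' : ℤ) :
    Commute (weightedShiftN n l c s d) (weightedShiftL n l c' s' d') := by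
  refine Finsupp.lhom_ext' fun x => LinearMap.ext_ring ?_
  change weightedShiftN n l c s d (weightedShiftL n l c' s' d' (wB n l x)) =
    weightedShiftL n l c' s' d' (weightedShiftN n l c s d (wB n l x))
  simp only [weightedShiftN, weightedShiftL, opOf_wB, map_smul]
  rw [smul_comm, add_right_comm]

theorem tN_eq_weightedShiftN (n l : ℕ) (i : ZMod n) :
    tN n l i = weightedShiftN n l
      (fun a => qq ^ ((if a = i then 1 else 0) - (if a = i + 1 then 1 else 0) : ℤ)) 0 0 := by
  simp only [tN, weightedShiftN, add_zero]

theorem eN_eq_weightedShiftN (n l : ℕ) (i : ZMod n) :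
    eN n l i = weightedShiftN n l
      (fun a => if a = i + 1 then 1 else 0) (-1) (if i = 0 then 1 else 0) := by
  simp only [eN, weightedShiftN, ite_smul, one_smul, zero_smul, sub_eq_add_neg]

theorem fN_eq_weightedShiftN (n l : ℕ) (i : ZMod n) :
    fN n l i = weightedShiftN n l
      (fun a => if a = i then 1 else 0) 1 (-if i = 0 then 1 else 0) := by
  simp only [fN, weightedShiftN, ite_smul, one_smul, zero_smul, sub_eq_add_neg]

theorem tL_eq_weightedShiftL (n l : ℕ) (j : ZMod l) :
    tL n l j = weightedShiftL n l
      (fun a => qq ^ ((if a = j then 1 else 0) - (if a = j + 1 then 1 else 0) : ℤ)) 0 0 := by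
  simp only [tL, weightedShiftL, add_zero]

theorem eL_eq_weightedShiftL (n l : ℕ) (j : ZMod l) :
    eL n l j = weightedShiftL n l
      (fun a => if a = j + 1 then 1 else 0) (-1) (if j = 0 then 1 else 0) := by
  simp only [eL, weightedShiftL, ite_smul, one_smul, zero_smul, sub_eq_add_neg]

theorem fL_eq_weightedShiftL (n l : ℕ) (j : ZMod l) :
    fL n l j = weightedShiftL n l
      (fun a => if a = j then 1 else 0) 1 (-if j = 0 then 1 else 0) := by
  simp only [fL, weightedShiftL, ite_smul, one_smul, zero_smul, sub_eq_add_neg]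

/-- each of the operators `tN i, eN i, fN i` (the `U_q'(sl_n^)`-action)
commutes with each of the operators `tL j, eL j, fL j` (the `U_q'(sl_l^)`-action). -/
theorem stmt_13 (n l : ℕ) (hn : 1 < n) (hl : 1 < l) :
    ∀ (i : ZMod n) (j : ZMod l),
      Commute (tN n l i) (tL n l j) ∧
      Commute (tN n l i) (eL n l j) ∧
      Commute (tN n l i) (fL n l j) ∧
      Commute (eN n l i) (tL n l j) ∧
      Commute (eN n l i) (eL n l j) ∧
      Commute (eN n l i) (fL n l j) ∧
      Commute (fN n l i) (tL n l j) ∧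
      Commute (fN n l i) (eL n l j) ∧
      Commute (fN n l i) (fL n l j) := by
  intro i j
  simp only [tN_eq_weightedShiftN, eN_eq_weightedShiftN, fN_eq_weightedShiftN,
    tL_eq_weightedShiftL, eL_eq_weightedShiftL, fL_eq_weightedShiftL,
    commute_weightedShift, and_self]
end
end
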